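/- Let T = (e₁,…,e₅) be any list of five 4-tuples of pairwise distinct indices in {1,…,8} such that every index in {1,…,8} occurs in at least one eᵢ. Then the cross-ratio degree of T is at most 4; i.e., there exists a nonzero polynomial q ∈ ℂ[x₁,…,x₅] such that for every (a₁,…,a₅) ∈ (ℂ∖{0,1})⁵ with q(a₁,…,a₅) ≠ 0, the set of tuples (p₁,…,p₈) of pairwise distinct points of ℙ¹(ℂ) with p₁ = ∞, p₂ = 0, p₃ = 1 and CR(p_{eᵢ,1},p_{eᵢ,2},p_{eᵢ,3},p_{eᵢ,4}) = aᵢ for i = 1,…,5 has at most 4 elements. In particular, the maximal cross-ratio degree for 8 points in ℙ¹ is at most 4. -/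

import Mathlib

open OnePoint

/-- Cross-ratio of four points of `ℙ¹(ℂ) = OnePoint ℂ`:
`CR(z₁,z₂,z₃,z₄) = ((z₃−z₁)(z₄−z₂))/((z₃−z₂)(z₄−z₁))` when all points are finite,
extended to one point at infinity by omitting the two factors containing it. -/
noncomputable def CR : OnePoint ℂ → OnePoint ℂ → OnePoint ℂ → OnePoint ℂ → ℂ
  | Option.none,    Option.some z₂, Option.some z₃, Option.some z₄ => (z₄ - z₂) / (z₃ - z₂)
  | Option.some z₁, Option.none,    Option.some z₃, Option.some z₄ => (z₃ - z₁) / (z₄ - z₁)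
  | Option.some z₁, Option.some z₂, Option.none,    Option.some z₄ => (z₄ - z₂) / (z₄ - z₁)
  | Option.some z₁, Option.some z₂, Option.some z₃, Option.none    => (z₃ - z₁) / (z₃ - z₂)
  | Option.some z₁, Option.some z₂, Option.some z₃, Option.some z₄ =>
      ((z₃ - z₁) * (z₄ - z₂)) / ((z₃ - z₂) * (z₄ - z₁))
  | _, _, _, _ => 0

/-- The bracket `u₁v₂ - u₂v₁` of two vectors of homogeneous coordinates. -/
def bracket {K : Type*} [CommRing K] (u v : K × K) : K := u.1 * v.2 - u.2 * v.1

/-- The homogeneous form of the equation `CR(w₀, w₁, w₂, w₃) = a`. -/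
def crossRel {K : Type*} [CommRing K] (a : K) (w : Fin 4 → K × K) : K :=
  bracket (w 2) (w 0) * bracket (w 3) (w 1) - a * (bracket (w 2) (w 1) * bracket (w 3) (w 0))

/-- Homogeneous coordinates of the configuration with `0`-th point `∞` and `v`-th point `z v`. -/
def homVec {K : Type*} [CommRing K] (z : Fin 8 → K) (v : Fin 8) : K × K :=
  if v = 0 then (1, 0) else (z v, 1)

lemma bracket_smul {K : Type*} [CommRing K] (c d : K) (u v : K × K) :
    bracket (c • u) (d • v) = c * d * bracket u v := by
  simp only [bracket, Prod.smul_fst, Prod.smul_snd, smul_eq_mul]; ring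

lemma bracket_map {K L : Type*} [CommRing K] [CommRing L] (φ : K →+* L) (u v : K × K) :
    bracket (Prod.map φ φ u) (Prod.map φ φ v) = φ (bracket u v) := by
  simp [bracket]

lemma crossRel_map {K L : Type*} [CommRing K] [CommRing L] (φ : K →+* L) (a : K)
    (w : Fin 4 → K × K) :
    crossRel (φ a) (fun j => Prod.map φ φ (w j)) = φ (crossRel a w) := by
  simp only [crossRel, bracket_map, map_sub, map_mul]

lemma homVec_map {K L : Type*} [CommRing K] [CommRing L] (φ : K →+* L) (z : Fin 8 → K)
    (v : Fin 8) : Prod.map φ φ (homVec z v) = homVec (fun v => φ (z v)) v := by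
  unfold homVec; split_ifs <;> simp

lemma crossRel_smul {K : Type*} [CommRing K] (a : K) (c : Fin 4 → K) (w : Fin 4 → K × K) :
    crossRel a (fun j => c j • w j) = c 0 * c 1 * c 2 * c 3 * crossRel a w := by
  simp only [crossRel, bracket_smul]; ring

lemma exists_smul_of_bracket_eq_zero {K : Type*} [Field K] {u v : K × K} (hv : v ≠ 0)
    (h : bracket u v = 0) : ∃ c : K, u = c • v := by
  have h' : u.1 * v.2 = u.2 * v.1 := sub_eq_zero.mp h
  by_cases h1 : v.1 = 0
  · have h2 : v.2 ≠ 0 := fun h2 => hv (Prod.ext h1 h2)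
    refine ⟨u.2 / v.2, Prod.ext ?_ ?_⟩
    · have : u.1 * v.2 = 0 := by rw [h', h1, mul_zero]
      simpa [h1, h2] using this
    · simp [h2]
  · refine ⟨u.1 / v.1, Prod.ext ?_ ?_⟩
    · simp [h1]
    · simp only [Prod.smul_snd, smul_eq_mul]
      field_simp
      linear_combination -h'

/-- In a cross-ratio equation on distinct points, each point is determined by the other three. -/
lemma bracket_eq_zero_of_crossRel {K : Type*} [Field K] {a : K} {w w' : Fin 4 → K × K}
    (hw : ∀ i j, i ≠ j → bracket (w i) (w j) ≠ 0) (h : crossRel a w = 0)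
    (h' : crossRel a w' = 0) (j : Fin 4) (hj : ∀ i, i ≠ j → w' i = w i) :
    bracket (w' j) (w j) = 0 := by
  unfold crossRel at h h'
  have key : ∀ p q r s x : K × K, bracket q r ≠ 0 → bracket q s ≠ 0 → bracket r s ≠ 0 →
      bracket p s ≠ 0 → bracket p r ≠ 0 →
      bracket r p * bracket s q - a * (bracket r q * bracket s p) = 0 →
      bracket r x * bracket s q - a * (bracket r q * bracket s x) = 0 → bracket x p = 0 := by
    intro p q r s x h1 h2 h3 h4 h5 e e'
    have : bracket x p * (bracket r s * bracket s q) = 0 := by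
      have e2 : bracket s p * (bracket r x * bracket s q - a * (bracket r q * bracket s x))
        - bracket s x * (bracket r p * bracket s q - a * (bracket r q * bracket s p)) = 0 := by
        rw [e, e']; ring
      rw [← e2]; simp only [bracket]; ring
    have h2' : bracket s q ≠ 0 := fun h => h2 (by
      have : bracket q s = - bracket s q := by simp only [bracket]; ring
      rw [this, h, neg_zero])
    rcases mul_eq_zero.mp this with h | h
    · exact h
    · exact absurd h (mul_ne_zero h3 h2')
  fin_cases j
  · rw [hj 1 (by decide), hj 2 (by decide), hj 3 (by decide)] at h'
    exact key (w 0) (w 1) (w 2) (w 3) (w' 0) (hw _ _ (by decide)) (hw _ _ (by decide))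
      (hw _ _ (by decide)) (hw _ _ (by decide)) (hw _ _ (by decide)) h h'
  · rw [hj 0 (by decide), hj 2 (by decide), hj 3 (by decide)] at h'
    exact key (w 1) (w 0) (w 3) (w 2) (w' 1) (hw _ _ (by decide)) (hw _ _ (by decide))
      (hw _ _ (by decide)) (hw _ _ (by decide)) (hw _ _ (by decide))
      (by linear_combination h) (by linear_combination h')
  · rw [hj 0 (by decide), hj 1 (by decide), hj 3 (by decide)] at h'
    exact key (w 2) (w 3) (w 0) (w 1) (w' 2) (hw _ _ (by decide)) (hw _ _ (by decide))
      (hw _ _ (by decide)) (hw _ _ (by decide)) (hw _ _ (by decide))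
      (by rw [← h]; simp only [bracket]; ring) (by rw [← h']; simp only [bracket]; ring)
  · rw [hj 0 (by decide), hj 1 (by decide), hj 2 (by decide)] at h'
    exact key (w 3) (w 2) (w 1) (w 0) (w' 3) (hw _ _ (by decide)) (hw _ _ (by decide))
      (hw _ _ (by decide)) (hw _ _ (by decide)) (hw _ _ (by decide))
      (by rw [← h]; simp only [bracket]; ring) (by rw [← h']; simp only [bracket]; ring)

/-- More rational functions than variables are algebraically dependent; the dependence is
evaluated at all points where the denominators do not vanish. -/
lemma exists_algebraic_relation {ι σ : Type} [Fintype ι] [Fintype σ]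
    (hcard : Fintype.card σ < Fintype.card ι) (N D : ι → MvPolynomial σ ℂ)
    (hD : ∀ i, D i ≠ 0) :
    ∃ Q : MvPolynomial ι ℂ, Q ≠ 0 ∧ ∀ (x : σ → ℂ) (a : ι → ℂ),
      (∀ i, MvPolynomial.eval x (D i) ≠ 0 ∧
        MvPolynomial.eval x (N i) = a i * MvPolynomial.eval x (D i)) →
      MvPolynomial.eval a Q = 0 := by
  classical
  set E : MvPolynomial σ ℂ := ∏ i, D i with hE
  have hE0 : E ≠ 0 := Finset.prod_ne_zero_iff.mpr fun i _ => hD i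
  let A := Localization.Away E
  have hle : Submonoid.powers E ≤ nonZeroDivisors (MvPolynomial σ ℂ) :=
    powers_le_nonZeroDivisors_of_noZeroDivisors hE0
  have : IsDomain A := IsLocalization.isDomain_localization hle
  have : FaithfulSMul (MvPolynomial σ ℂ) A :=
    (faithfulSMul_iff_algebraMap_injective _ _).mpr (IsLocalization.injective A hle)
  have : Algebra.IsAlgebraic (MvPolynomial σ ℂ) A :=
    IsLocalization.isAlgebraic _ (Submonoid.powers E)
  have htr : Algebra.trdeg ℂ A = Fintype.card σ := by
    have h1 := trdeg_add_eq ℂ (MvPolynomial σ ℂ) (A := A)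
    rw [trdeg_eq_zero (R := MvPolynomial σ ℂ) (A := A), MvPolynomial.trdeg_of_isDomain] at h1
    rw [← h1]; simp
  have hu : ∀ i, IsUnit (algebraMap (MvPolynomial σ ℂ) A (D i)) := fun i =>
    isUnit_of_dvd_unit (map_dvd _ (Finset.dvd_prod_of_mem D (Finset.mem_univ i)))
      (IsLocalization.Away.algebraMap_isUnit (S := A) E)
  let f : ι → A := fun i => algebraMap _ A (N i) * ((hu i).unit⁻¹ : Aˣ)
  have hf : ∀ i, f i * algebraMap _ A (D i) = algebraMap _ A (N i) := fun i => by
    simp only [f, mul_assoc, (hu i).val_inv_mul, mul_one]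
  have hdep : ¬ AlgebraicIndependent ℂ f := fun h => by
    have := h.lift_cardinalMk_le_trdeg
    rw [htr] at this
    simp only [Cardinal.mk_fintype, Cardinal.lift_natCast, Nat.cast_le] at this
    omega
  rw [algebraicIndependent_iff] at hdep
  push Not at hdep
  obtain ⟨Q, hQ, hQ0⟩ := hdep
  refine ⟨Q, hQ0, fun x a hxa => ?_⟩
  have hEx : IsUnit ((MvPolynomial.aeval x : MvPolynomial σ ℂ →ₐ[ℂ] ℂ) E) := by
    rw [isUnit_iff_ne_zero, hE, map_prod]
    exact Finset.prod_ne_zero_iff.mpr fun i _ => by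
      simpa [MvPolynomial.aeval_eq_eval] using (hxa i).1
  let φ : A →ₐ[ℂ] ℂ := IsLocalization.liftAlgHom (M := Submonoid.powers E)
    (f := (MvPolynomial.aeval x : MvPolynomial σ ℂ →ₐ[ℂ] ℂ)) (by
      rintro ⟨_, n, rfl⟩
      simpa using hEx.pow n)
  have hφ : ∀ p : MvPolynomial σ ℂ, φ (algebraMap _ A p) = MvPolynomial.eval x p := fun p => by
    simp only [φ, IsLocalization.liftAlgHom_apply, IsLocalization.lift_eq]
    simp
  have hφf : (fun i => φ (f i)) = a := by
    funext i
    have := congrArg φ (hf i)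
    rw [map_mul, hφ, hφ, (hxa i).2] at this
    exact mul_right_cancel₀ (hxa i).1 this
  have := congrArg φ hQ
  rw [MvPolynomial.comp_aeval_apply, map_zero] at this
  rw [← this, ← hφf, MvPolynomial.aeval_eq_eval]

/-- `z` describes the first `n` points `∞, 0, 1, z 3, …, z (n - 1)` of a configuration satisfying
the first `n - 3` equations of `T`; the remaining coordinates are set to zero. -/
structure IsPartialSol (T : Fin 5 → Fin 4 → Fin 8) (n : ℕ) (a : Fin 5 → ℂ) (z : Fin 8 → ℂ) :
    Prop where
  zero : z 0 = 0
  one : z 1 = 0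
  two : z 2 = 1
  tail : ∀ v : Fin 8, n ≤ v → z v = 0
  distinct : ∀ v w : Fin 8, (v : ℕ) < n → (w : ℕ) < n → v ≠ w →
    bracket (homVec z v) (homVec z w) ≠ 0
  rel : ∀ i : Fin 5, (i : ℕ) + 3 < n → crossRel (a i) (fun j => homVec z (T i j)) = 0

/-- The configuration `∞, 0, 1, X₀, …, X_{m-1}` with indeterminate entries. -/
noncomputable def genericConfig (m : ℕ) (v : Fin 8) : MvPolynomial (Fin m) ℂ :=
  if h : 3 ≤ (v : ℕ) ∧ (v : ℕ) - 3 < m then MvPolynomial.X ⟨v - 3, h.2⟩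
  else if v = 2 then 1 else 0

lemma homVec_genericConfig {m : ℕ} (hm : m ≤ 5) {z : Fin 8 → ℂ} (h1 : z 1 = 0) (h2 : z 2 = 1)
    (v : Fin 8) (hv : (v : ℕ) < m + 3) :
    Prod.map (MvPolynomial.eval fun k : Fin m => z ⟨k + 3, by omega⟩)
      (MvPolynomial.eval fun k : Fin m => z ⟨k + 3, by omega⟩) (homVec (genericConfig m) v) =
      homVec z v := by
  rw [homVec_map]
  unfold homVec
  split_ifs with h0
  · rfl
  · congr 1
    unfold genericConfig
    beta_reduce
    by_cases h : 3 ≤ (v : ℕ) ∧ (v : ℕ) - 3 < m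
    · rw [dif_pos h, MvPolynomial.eval_X]
      congr 1
      ext
      simp only
      omega
    · rw [dif_neg h]
      have h3 : (v : ℕ) < 3 := by omega
      split_ifs with hv2
      · rw [hv2, h2, map_one]
      · have : v = 1 := by omega
        rw [this, h1, map_zero]

lemma bracket_genericConfig_ne_zero {m : ℕ} (hm : m ≤ 5) {v w : Fin 8} (hv : (v : ℕ) < m + 3)
    (hw : (w : ℕ) < m + 3) (hvw : v ≠ w) :
    bracket (homVec (genericConfig m) v) (homVec (genericConfig m) w) ≠ 0 := by
  intro h
  let z : Fin 8 → ℂ := fun v => ((v : ℕ) : ℂ) - 1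
  have h1 : z 1 = 0 := by simp [z]
  have h2 : z 2 = 1 := by norm_num [z]
  have := bracket_map (MvPolynomial.eval fun k : Fin m => z ⟨k + 3, by omega⟩)
    (homVec (genericConfig m) v) (homVec (genericConfig m) w)
  rw [homVec_genericConfig hm h1 h2 v hv, homVec_genericConfig hm h1 h2 w hw, h, map_zero] at this
  unfold homVec bracket at this
  split_ifs at this with h3 h4 h4
  · exact hvw (h3.trans h4.symm)
  · simp at this
  · simp at this
  · have h5 : ((v : ℕ) : ℂ) = (w : ℕ) := by
      simp only [z] at this; linear_combination this
    exact hvw (Fin.ext (by exact_mod_cast h5))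

/-- Numerator of the cross-ratio of the generic points with indices `e`. -/
noncomputable def genericNum (m : ℕ) (e : Fin 4 → Fin 8) : MvPolynomial (Fin m) ℂ :=
  bracket (homVec (genericConfig m) (e 2)) (homVec (genericConfig m) (e 0)) *
    bracket (homVec (genericConfig m) (e 3)) (homVec (genericConfig m) (e 1))

/-- Denominator of the cross-ratio of the generic points with indices `e`. -/
noncomputable def genericDen (m : ℕ) (e : Fin 4 → Fin 8) : MvPolynomial (Fin m) ℂ :=
  bracket (homVec (genericConfig m) (e 2)) (homVec (genericConfig m) (e 1)) *
    bracket (homVec (genericConfig m) (e 3)) (homVec (genericConfig m) (e 0))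

lemma genericDen_ne_zero {m : ℕ} (hm : m ≤ 5) {e : Fin 4 → Fin 8} (he : Function.Injective e)
    (hlt : ∀ j, (e j : ℕ) < m + 3) : genericDen m e ≠ 0 :=
  mul_ne_zero
    (bracket_genericConfig_ne_zero hm (hlt _) (hlt _) (he.ne (by decide)))
    (bracket_genericConfig_ne_zero hm (hlt _) (hlt _) (he.ne (by decide)))

lemma eval_genericNum_genericDen {m : ℕ} (hm : m ≤ 5) {e : Fin 4 → Fin 8}
    (he : Function.Injective e) (hlt : ∀ j, (e j : ℕ) < m + 3) {z : Fin 8 → ℂ} (h1 : z 1 = 0)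
    (h2 : z 2 = 1) (hz : ∀ v w : Fin 8, (v : ℕ) < m + 3 → (w : ℕ) < m + 3 → v ≠ w →
      bracket (homVec z v) (homVec z w) ≠ 0) {a : ℂ}
    (hrel : crossRel a (fun j => homVec z (e j)) = 0) :
    MvPolynomial.eval (fun k : Fin m => z ⟨k + 3, by omega⟩) (genericDen m e) ≠ 0 ∧
      MvPolynomial.eval (fun k : Fin m => z ⟨k + 3, by omega⟩) (genericNum m e) =
        a * MvPolynomial.eval (fun k : Fin m => z ⟨k + 3, by omega⟩) (genericDen m e) := by
  simp only [genericDen, genericNum, map_mul, ← bracket_map,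
    homVec_genericConfig hm h1 h2 _ (hlt _)]
  refine ⟨mul_ne_zero (hz _ _ (hlt _) (hlt _) (he.ne (by decide)))
    (hz _ _ (hlt _) (hlt _) (he.ne (by decide))), ?_⟩
  exact sub_eq_zero.mp hrel

/-- For generic cross-ratios there is no configuration if some `m + 1` of the equations involve
only `m + 3` of the points. -/
lemma exists_forall_not_isPartialSol (T : Fin 5 → Fin 4 → Fin 8)
    (hT : ∀ i, Function.Injective (T i)) {m : ℕ} (hm : m ≤ 5) (ρ : Fin (m + 1) → Fin 5)
    (hinj : Function.Injective ρ) (hρ : ∀ i j, (T (ρ i) j : ℕ) < m + 3) :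
    ∃ q : MvPolynomial (Fin 5) ℂ, q ≠ 0 ∧ ∀ a, MvPolynomial.eval a q ≠ 0 →
      ∀ z, ¬ IsPartialSol T 8 a z := by
  obtain ⟨Q, hQ0, hQ⟩ := exists_algebraic_relation (ι := Fin (m + 1)) (σ := Fin m) (by simp)
    (fun i => genericNum m (T (ρ i))) (fun i => genericDen m (T (ρ i)))
    (fun i => genericDen_ne_zero hm (hT _) (hρ i))
  refine ⟨MvPolynomial.rename ρ Q, fun h => hQ0 ?_, fun a ha z hz => ha ?_⟩
  · exact (map_eq_zero_iff _ (MvPolynomial.rename_injective _ hinj)).mp h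
  · rw [MvPolynomial.eval_rename]
    exact hQ (fun k : Fin m => z ⟨k + 3, by omega⟩) _ fun i =>
      eval_genericNum_genericDen hm (hT _) (hρ i) hz.one hz.two
        (fun v w _ _ => hz.distinct v w (by omega) (by omega)) (hz.rel _ (by omega))

/-- For generic cross-ratios there are finitely many partial solutions, if the equations
concerned involve only the first `m + 3` points. -/
lemma exists_forall_finite (T : Fin 5 → Fin 4 → Fin 8)
    (hT : ∀ i, Function.Injective (T i)) {m : ℕ} (hm : m ≤ 5)
    (hlt : ∀ i : Fin 5, (i : ℕ) < m → ∀ j, (T i j : ℕ) < m + 3) :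
    ∃ q : MvPolynomial (Fin 5) ℂ, q ≠ 0 ∧ ∀ a, MvPolynomial.eval a q ≠ 0 →
      {z | IsPartialSol T (m + 3) a z}.Finite := by
  have main : ∀ k : Fin m, ∃ q : MvPolynomial (Fin 5) ℂ, q ≠ 0 ∧ ∀ a, MvPolynomial.eval a q ≠ 0 →
      ∃ F : Set ℂ, F.Finite ∧ ∀ z, IsPartialSol T (m + 3) a z → z ⟨k + 3, by omega⟩ ∈ F := by
    intro k
    obtain ⟨Q, hQ0, hQ⟩ := exists_algebraic_relation (ι := Fin (m + 1)) (σ := Fin m) (by simp)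
      (Fin.cons (MvPolynomial.X k) fun i => genericNum m (T (Fin.castLE hm i)))
      (Fin.cons 1 fun i => genericDen m (T (Fin.castLE hm i)))
      (Fin.cases (by simp) fun i => by
        simpa using genericDen_ne_zero hm (hT _) (hlt (Fin.castLE hm i) (by simp)))
    set P := MvPolynomial.finSuccEquiv ℂ m Q with hP
    have hP0 : P ≠ 0 := by simpa [hP] using hQ0
    refine ⟨MvPolynomial.rename (Fin.castLE hm) P.leadingCoeff, fun h => hP0 ?_,
      fun a ha => ⟨{x | (P.map (MvPolynomial.eval (a ∘ Fin.castLE hm))).IsRoot x}, ?_,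
        fun z hz => ?_⟩⟩
    · rw [← Polynomial.leadingCoeff_eq_zero]
      exact (map_eq_zero_iff _ (MvPolynomial.rename_injective _ (Fin.castLE_injective hm))).mp h
    · refine Polynomial.finite_setOfPred_isRoot fun h => ha ?_
      rw [MvPolynomial.eval_rename]
      have := congrArg (fun p => Polynomial.coeff p P.natDegree) h
      simpa using this
    · have := hQ (fun k : Fin m => z ⟨k + 3, by omega⟩)
        (Fin.cons (z ⟨k + 3, by omega⟩) (a ∘ Fin.castLE hm)) (Fin.cases (by simp) fun i => by
          simpa using eval_genericNum_genericDen hm (hT _) (hlt (Fin.castLE hm i) (by simp))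
            hz.one hz.two hz.distinct (hz.rel (Fin.castLE hm i) (by simp)))
      rw [MvPolynomial.eval_eq_eval_mv_eval'] at this
      exact this
  choose q hq0 hq using main
  refine ⟨∏ k, q k, Finset.prod_ne_zero_iff.mpr fun k _ => hq0 k, fun a ha => ?_⟩
  rw [map_prod, Finset.prod_ne_zero_iff] at ha
  choose F hF hzF using fun k => hq k a (ha k (Finset.mem_univ k))
  refine (Set.Finite.pi (t := fun v : Fin 8 =>
    if h : 3 ≤ (v : ℕ) ∧ (v : ℕ) - 3 < m then F ⟨v - 3, h.2⟩ else {0, 1}) fun v => ?_).subset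
    fun z hz v _ => ?_
  · split_ifs with h
    · exact hF _
    · exact Set.toFinite _
  · simp only
    split_ifs with h
    · have := hzF ⟨v - 3, h.2⟩ z hz
      convert this using 2
      ext
      simp only
      omega
    · by_cases hv : (v : ℕ) < 3
      · have : v = 0 ∨ v = 1 ∨ v = 2 := by omega
        rcases this with rfl | rfl | rfl
        · simp [hz.zero]
        · simp [hz.one]
        · simp [hz.two]
      · simp [hz.tail v (by omega)]

lemma homVec_ne_zero (z : Fin 8 → ℂ) (v : Fin 8) : homVec z v ≠ 0 := by
  unfold homVec
  split_ifs <;> simp [Prod.ext_iff]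

lemma eq_of_bracket_homVec_eq_zero {z z' : Fin 8 → ℂ} {v : Fin 8} (hv : v ≠ 0)
    (h : bracket (homVec z v) (homVec z' v) = 0) : z v = z' v := by
  simp only [homVec, if_neg hv, bracket] at h
  linear_combination h

lemma bracket_self {K : Type*} [CommRing K] (u : K × K) : bracket u u = 0 := by
  simp only [bracket]; ring

/-- Projective version of `bracket_eq_zero_of_crossRel`. -/
lemma bracket_eq_zero_of_crossRel_of_bracket {K : Type*} [Field K] {a : K} {w w' : Fin 4 → K × K}
    (hw : ∀ i j, i ≠ j → bracket (w i) (w j) ≠ 0) (h : crossRel a w = 0)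
    (h' : crossRel a w' = 0) (j : Fin 4)
    (hj : ∀ i, i ≠ j → w' i ≠ 0 ∧ bracket (w' i) (w i) = 0) :
    bracket (w' j) (w j) = 0 := by
  have hc : ∀ i, ∃ c : K, c ≠ 0 ∧ w' i = c • (if i = j then w' i else w i) := by
    intro i
    by_cases hi : i = j
    · exact ⟨1, one_ne_zero, by simp [hi]⟩
    · have hwi : w i ≠ 0 := fun h0 => hw i j hi (by simp [h0, bracket])
      obtain ⟨c, hc⟩ := exists_smul_of_bracket_eq_zero hwi (hj i hi).2
      refine ⟨c, fun h0 => (hj i hi).1 (by rw [hc, h0, zero_smul]), by rw [if_neg hi, hc]⟩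
  choose c hc0 hc using hc
  have h2 := crossRel_smul a c (fun i => if i = j then w' i else w i)
  simp only [← hc] at h2
  have h3 := bracket_eq_zero_of_crossRel (w' := fun i => if i = j then w' i else w i) hw h
    (by
      rw [show crossRel a w' = 0 from h'] at h2
      rcases mul_eq_zero.mp h2.symm with h4 | h4
      · exact absurd h4 (by simp [hc0])
      · exact h4) j (fun i hi => by simp [hi])
  simpa using h3

lemma natDegree_bracket_le {u v : Polynomial ℂ × Polynomial ℂ} {d e : ℕ}
    (hu : u.1.natDegree ≤ d ∧ u.2.natDegree ≤ d) (hv : v.1.natDegree ≤ e ∧ v.2.natDegree ≤ e) :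
    (bracket u v).natDegree ≤ d + e := by
  refine (Polynomial.natDegree_sub_le _ _).trans (max_le ?_ ?_) <;>
  exact Polynomial.natDegree_mul_le.trans (by omega)

lemma natDegree_crossRel_le (a : ℂ) {w : Fin 4 → Polynomial ℂ × Polynomial ℂ} {d : Fin 4 → ℕ}
    (h : ∀ j, (w j).1.natDegree ≤ d j ∧ (w j).2.natDegree ≤ d j) :
    (crossRel (Polynomial.C a) w).natDegree ≤ ∑ j, d j := by
  rw [Fin.sum_univ_four]
  have h1 := natDegree_bracket_le (h 2) (h 0)
  have h2 := natDegree_bracket_le (h 3) (h 1)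
  have h3 := natDegree_bracket_le (h 2) (h 1)
  have h4 := natDegree_bracket_le (h 3) (h 0)
  refine (Polynomial.natDegree_sub_le _ _).trans (max_le ?_ ?_)
  · exact Polynomial.natDegree_mul_le.trans (by omega)
  · refine (Polynomial.natDegree_C_mul_le _ _).trans (Polynomial.natDegree_mul_le.trans (by omega))

/-- Evaluation of a vector of polynomials. -/
noncomputable def evalPair (x : ℂ) (u : Polynomial ℂ × Polynomial ℂ) : ℂ × ℂ :=
  Prod.map (Polynomial.evalRingHom x) (Polynomial.evalRingHom x) u

lemma evalPair_C (x : ℂ) (u : ℂ × ℂ) : evalPair x (Prod.map Polynomial.C Polynomial.C u) = u := by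
  ext <;> simp [evalPair]

lemma bracket_evalPair (x : ℂ) (u v : Polynomial ℂ × Polynomial ℂ) :
    bracket (evalPair x u) (evalPair x v) = (bracket u v).eval x :=
  bracket_map (Polynomial.evalRingHom x) u v

lemma crossRel_evalPair (x a : ℂ) (w : Fin 4 → Polynomial ℂ × Polynomial ℂ) :
    crossRel a (fun j => evalPair x (w j)) = (crossRel (Polynomial.C a) w).eval x := by
  have := crossRel_map (Polynomial.evalRingHom x) (Polynomial.C a) w
  simpa [evalPair] using this

/-- The Möbius transformation taking three prescribed values at three prescribed points. -/
lemma exists_interpolation {x y : Fin 3 → ℂ} (hx : Function.Injective x)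
    (hy : Function.Injective y) :
    ∃ u : Polynomial ℂ × Polynomial ℂ, (u.1.natDegree ≤ 1 ∧ u.2.natDegree ≤ 1) ∧
      (∀ t, evalPair t u ≠ 0) ∧ ∀ k, bracket (evalPair (x k) u) (y k, 1) = 0 := by
  have hx01 : x 0 - x 1 ≠ 0 := sub_ne_zero.mpr (hx.ne (by decide))
  have hx20 : x 2 - x 0 ≠ 0 := sub_ne_zero.mpr (hx.ne (by decide))
  have hx21 : x 2 - x 1 ≠ 0 := sub_ne_zero.mpr (hx.ne (by decide))
  have hy01 : y 0 - y 1 ≠ 0 := sub_ne_zero.mpr (hy.ne (by decide))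
  have hy02 : y 0 - y 2 ≠ 0 := sub_ne_zero.mpr (hy.ne (by decide))
  have hy12 : y 1 - y 2 ≠ 0 := sub_ne_zero.mpr (hy.ne (by decide))
  let α : Polynomial ℂ :=
    Polynomial.C ((x 2 - x 0) * (y 1 - y 2)) * (Polynomial.X - Polynomial.C (x 1))
  let β : Polynomial ℂ :=
    Polynomial.C ((x 2 - x 1) * (y 0 - y 2)) * (Polynomial.X - Polynomial.C (x 0))
  have hα : α.natDegree ≤ 1 :=
    (Polynomial.natDegree_C_mul_le _ _).trans (Polynomial.natDegree_X_sub_C_le _)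
  have hβ : β.natDegree ≤ 1 :=
    (Polynomial.natDegree_C_mul_le _ _).trans (Polynomial.natDegree_X_sub_C_le _)
  have heval : ∀ t, evalPair t (α * Polynomial.C (y 0) - β * Polynomial.C (y 1), α - β) =
      ((x 2 - x 0) * (y 1 - y 2) * (t - x 1) * y 0 - (x 2 - x 1) * (y 0 - y 2) * (t - x 0) * y 1,
        (x 2 - x 0) * (y 1 - y 2) * (t - x 1) - (x 2 - x 1) * (y 0 - y 2) * (t - x 0)) := by
    intro t; simp [evalPair, α, β]
  refine ⟨(α * Polynomial.C (y 0) - β * Polynomial.C (y 1), α - β), ⟨?_, ?_⟩, fun t ht => ?_,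
    fun k => ?_⟩
  · refine (Polynomial.natDegree_sub_le _ _).trans (max_le ?_ ?_)
    · exact (Polynomial.natDegree_mul_C_le _ _).trans hα
    · exact (Polynomial.natDegree_mul_C_le _ _).trans hβ
  · exact (Polynomial.natDegree_sub_le _ _).trans (max_le hα hβ)
  · rw [heval, Prod.mk_eq_zero] at ht
    obtain ⟨h1, h2⟩ := ht
    have h3 : (x 2 - x 0) * (y 1 - y 2) * (y 0 - y 1) * (t - x 1) = 0 := by
      linear_combination h1 - y 1 * h2
    have h4 : (x 2 - x 1) * (y 0 - y 2) * (y 0 - y 1) * (t - x 0) = 0 := by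
      linear_combination h1 - y 0 * h2
    have h5 : t - x 1 = 0 := by simpa [hx20, hy12, hy01] using h3
    have h6 : t - x 0 = 0 := by simpa [hx21, hy02, hy01] using h4
    exact hx01 (by linear_combination h5 - h6)
  · rw [heval]
    fin_cases k <;> simp only [bracket, Fin.zero_eta, Fin.mk_one, Fin.reduceFinMk] <;> ring

/-- The equations with indices `r - 3, …, n - 4` attach the points `r, …, n - 1` to the previous
ones: all but the last one link a new point `v > r` to an earlier one of the block. -/
structure TreeBlock (T : Fin 5 → Fin 4 → Fin 8) (r : Fin 8) (n d : ℕ) : Prop where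
  three_le : 3 ≤ (r : ℕ)
  lt : (r : ℕ) < n
  le : n ≤ 8
  before : ∀ i : Fin 5, (i : ℕ) + 3 < r → ∀ j, T i j < r
  tree : ∀ (i : Fin 5) (v : Fin 8), r < v → (v : ℕ) < n → (i : ℕ) + 4 = v →
    ∃ j₀ j₁, j₀ ≠ j₁ ∧ T i j₀ = v ∧ r ≤ T i j₁ ∧ T i j₁ < v ∧
      ∀ j, j ≠ j₀ → j ≠ j₁ → T i j < r
  closing : ∀ i : Fin 5, (i : ℕ) + 4 = n → ∀ j, (T i j : ℕ) < n
  card_closing : ∀ i : Fin 5, (i : ℕ) + 4 = n → (Finset.univ.filter fun j => r ≤ T i j).card ≤ d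
  two_le : 2 ≤ d

namespace TreeBlock

variable {T : Fin 5 → Fin 4 → Fin 8} {r : Fin 8} {n d : ℕ}

lemma lt_of_rel (hB : TreeBlock T r n d) (i : Fin 5) (hi : (i : ℕ) + 3 < n) (j : Fin 4) :
    (T i j : ℕ) < n := by
  have h3 := hB.three_le
  have hlt := hB.lt
  have hle := hB.le
  by_cases h1 : (i : ℕ) + 4 = n
  · exact hB.closing i h1 j
  by_cases h2 : (i : ℕ) + 3 < r
  · have := Fin.lt_def.mp (hB.before i h2 j)
    omega
  obtain ⟨j₀, j₁, -, e0, -, e1, he⟩ := hB.tree i ⟨i + 4, by omega⟩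
    (Fin.lt_def.mpr (by simp only; omega)) (by simp only; omega) rfl
  by_cases h4 : j = j₀
  · rw [h4, e0]; simp only; omega
  by_cases h5 : j = j₁
  · rw [h5]; have := Fin.lt_def.mp e1; simp only at this; omega
  · have := Fin.lt_def.mp (he j h4 h5); omega

lemma card_le_two (hB : TreeBlock T r n d) (i : Fin 5) (hi : (i : ℕ) + 4 < n) :
    (Finset.univ.filter fun j => r ≤ T i j).card ≤ 2 := by
  have h3 := hB.three_le
  have hle := hB.le
  by_cases h2 : (i : ℕ) + 3 < r
  · rw [Finset.filter_false_of_mem fun j _ => not_le.mpr (hB.before i h2 j)]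
    simp
  obtain ⟨j₀, j₁, -, -, -, -, he⟩ := hB.tree i ⟨i + 4, by omega⟩
    (Fin.lt_def.mpr (by simp only; omega)) (by simp only; omega) rfl
  refine (Finset.card_le_card (t := {j₀, j₁}) fun j hj => ?_).trans Finset.card_le_two
  by_contra hj'
  simp only [Finset.mem_insert, Finset.mem_singleton, not_or] at hj'
  exact absurd (Finset.mem_filter.mp hj).2 (not_le.mpr (he j hj'.1 hj'.2))

variable {a : Fin 5 → ℂ} {z : Fin 8 → ℂ} {U : Fin 8 → ℂ × ℂ}

/-- The equations of a tree block determine all its points from the root. -/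
lemma bracket_eq_zero_of_root (hB : TreeBlock T r n d) (hT : ∀ i, Function.Injective (T i))
    (hz : IsPartialSol T n a z) (hU : ∀ v : Fin 8, (v : ℕ) < n → U v ≠ 0)
    (hrel : ∀ i : Fin 5, (i : ℕ) + 4 < n → crossRel (a i) (fun j => U (T i j)) = 0)
    (h : ∀ v ≤ r, bracket (U v) (homVec z v) = 0) (v : Fin 8) (hv : (v : ℕ) < n) :
    bracket (U v) (homVec z v) = 0 := by
  induction v using WellFoundedLT.induction with
  | ind v ih =>
    have h3 := hB.three_le
    have hle := hB.le
    rcases le_or_gt v r with hvr | hvr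
    · exact h v hvr
    have hvr' := Fin.lt_def.mp hvr
    let i : Fin 5 := ⟨v - 4, by omega⟩
    have hi : (i : ℕ) + 4 = v := by simp only [i]; omega
    obtain ⟨j₀, j₁, h01, e0, -, e1, he⟩ := hB.tree i v hvr hv hi
    have key := bracket_eq_zero_of_crossRel_of_bracket (w := fun j => homVec z (T i j))
      (w' := fun j => U (T i j))
      (fun j k hjk => hz.distinct _ _ (hB.lt_of_rel i (by omega) j) (hB.lt_of_rel i (by omega) k)
        ((hT i).ne hjk)) (hz.rel i (by omega)) (hrel i (by omega)) j₀
      (fun j hj => by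
        refine ⟨hU _ (hB.lt_of_rel i (by omega) j), ?_⟩
        by_cases hj1 : j = j₁
        · exact ih _ (hj1 ▸ e1) (hB.lt_of_rel i (by omega) j)
        · exact h _ (he j hj hj1).le)
    simpa only [e0] using key

/-- The equations of a tree block determine the root from any of the other points. -/
lemma bracket_root_eq_zero (hB : TreeBlock T r n d) (hT : ∀ i, Function.Injective (T i))
    (hz : IsPartialSol T n a z) (hU : ∀ v : Fin 8, (v : ℕ) < n → U v ≠ 0)
    (hrel : ∀ i : Fin 5, (i : ℕ) + 4 < n → crossRel (a i) (fun j => U (T i j)) = 0)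
    (h : ∀ v < r, bracket (U v) (homVec z v) = 0) (v : Fin 8) (hv : (v : ℕ) < n) (hrv : r ≤ v)
    (h' : bracket (U v) (homVec z v) = 0) : bracket (U r) (homVec z r) = 0 := by
  induction v using WellFoundedLT.induction with
  | ind v ih =>
    have h3 := hB.three_le
    have hle := hB.le
    rcases hrv.eq_or_lt with hvr | hvr
    · rwa [hvr]
    have hvr' := Fin.lt_def.mp hvr
    let i : Fin 5 := ⟨v - 4, by omega⟩
    have hi : (i : ℕ) + 4 = v := by simp only [i]; omega
    obtain ⟨j₀, j₁, h01, e0, er, e1, he⟩ := hB.tree i v hvr hv hi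
    have key := bracket_eq_zero_of_crossRel_of_bracket (w := fun j => homVec z (T i j))
      (w' := fun j => U (T i j))
      (fun j k hjk => hz.distinct _ _ (hB.lt_of_rel i (by omega) j) (hB.lt_of_rel i (by omega) k)
        ((hT i).ne hjk)) (hz.rel i (by omega)) (hrel i (by omega)) j₁
      (fun j hj => by
        refine ⟨hU _ (hB.lt_of_rel i (by omega) j), ?_⟩
        by_cases hj0 : j = j₀
        · rw [hj0, e0]; exact h'
        · exact h _ (he j hj0 hj))
    exact ih _ e1 (hB.lt_of_rel i (by omega) j₁) er key

end TreeBlock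

namespace TreeBlock

variable {T : Fin 5 → Fin 4 → Fin 8} {r : Fin 8} {n d : ℕ} {a : Fin 5 → ℂ}

lemma eq_root_of_eq (hB : TreeBlock T r n d) (hT : ∀ i, Function.Injective (T i))
    {z z' : Fin 8 → ℂ} (hz : IsPartialSol T n a z) (hz' : IsPartialSol T n a z')
    (h : ∀ v < r, z v = z' v) (v : Fin 8) (hv : (v : ℕ) < n) (hrv : r ≤ v) (h' : z v = z' v) :
    z r = z' r := by
  have h3 := hB.three_le
  have hhom : ∀ w, z w = z' w → bracket (homVec z w) (homVec z' w) = 0 := fun w hw => by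
    have : homVec z w = homVec z' w := by simp only [homVec, hw]
    rw [this, bracket_self]
  refine eq_of_bracket_homVec_eq_zero (fun h0 => ?_) (hB.bracket_root_eq_zero hT hz'
    (fun v _ => homVec_ne_zero z v) (fun i hi => hz.rel i (by omega))
    (fun w hw => hhom w (h w hw)) v hv hrv (hhom v h'))
  rw [h0] at h3
  simp at h3

lemma eq_of_eq_root (hB : TreeBlock T r n d) (hT : ∀ i, Function.Injective (T i))
    {z z' : Fin 8 → ℂ} (hz : IsPartialSol T n a z) (hz' : IsPartialSol T n a z')
    (h : ∀ v ≤ r, z v = z' v) : z = z' := by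
  funext v
  rcases lt_or_ge (v : ℕ) n with hv | hv
  · by_cases hv0 : v = 0
    · rw [hv0, hz.zero, hz'.zero]
    · refine eq_of_bracket_homVec_eq_zero hv0 (hB.bracket_eq_zero_of_root hT hz'
        (fun v _ => homVec_ne_zero z v) (fun i hi => hz.rel i (by omega)) (fun w hw => ?_) v hv)
      have : homVec z w = homVec z' w := by simp only [homVec, h w hw]
      rw [this, bracket_self]
  · rw [hz.tail v hv, hz'.tail v hv]

/-- The degree in the root of the coordinates of the points of a block. -/
def coordDegree (r v : Fin 8) : ℕ := if r ≤ v then 1 else 0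

lemma sum_coordDegree (r : Fin 8) (e : Fin 4 → Fin 8) :
    ∑ j, coordDegree r (e j) = (Finset.univ.filter fun j => r ≤ e j).card := by
  simp only [coordDegree, Finset.sum_boole, Nat.cast_id]

/-- The points of a block as linear functions of the root, interpolating three solutions. -/
lemma exists_interpolating_family (hB : TreeBlock T r n d) (hT : ∀ i, Function.Injective (T i))
    {p : Fin 3 → Fin 8 → ℂ} (hp : ∀ k, IsPartialSol T n a (p k))
    (hinj : Function.Injective fun k => p k r) (hag : ∀ k l, ∀ v < r, p k v = p l v) :
    ∃ U : Fin 8 → Polynomial ℂ × Polynomial ℂ,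
      (∀ v < r, U v = Prod.map Polynomial.C Polynomial.C (homVec (p 0) v)) ∧
      U r = (Polynomial.X, 1) ∧ ∀ v : Fin 8, (v : ℕ) < n →
        ((U v).1.natDegree ≤ coordDegree r v ∧ (U v).2.natDegree ≤ coordDegree r v) ∧
        (∀ x, evalPair x (U v) ≠ 0) ∧
        ∀ k, bracket (evalPair (p k r) (U v)) (homVec (p k) v) = 0 := by
  have h3 := hB.three_le
  have hr0 : r ≠ 0 := fun h => by rw [h] at h3; simp at h3
  have main : ∀ v : Fin 8, ∃ u : Polynomial ℂ × Polynomial ℂ,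
      (v < r → u = Prod.map Polynomial.C Polynomial.C (homVec (p 0) v)) ∧
      (v = r → u = (Polynomial.X, 1)) ∧ ((v : ℕ) < n →
        (u.1.natDegree ≤ coordDegree r v ∧ u.2.natDegree ≤ coordDegree r v) ∧
        (∀ x, evalPair x u ≠ 0) ∧
        ∀ k, bracket (evalPair (p k r) u) (homVec (p k) v) = 0) := by
    intro v
    rcases lt_trichotomy v r with hv | hv | hv
    · have hev : ∀ x, evalPair x (Prod.map Polynomial.C Polynomial.C (homVec (p 0) v)) =
          homVec (p 0) v := fun x =>
        evalPair_C x _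
      refine ⟨_, fun _ => rfl, fun h => absurd h hv.ne, fun _ => ⟨?_, fun x => ?_, fun k => ?_⟩⟩
      · simp
      · rw [hev]; exact homVec_ne_zero _ _
      · have : homVec (p k) v = homVec (p 0) v := by simp only [homVec, hag k 0 v hv]
        rw [hev, this, bracket_self]
    · refine ⟨(Polynomial.X, 1), fun h => absurd hv h.ne, fun _ => rfl,
        fun _ => ⟨?_, fun x => ?_, fun k => ?_⟩⟩
      · simp [coordDegree, hv]
      · simp [evalPair, Prod.ext_iff]
      · simp [evalPair, bracket, homVec, hv, hr0]
    · by_cases hvn : (v : ℕ) < n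
      · have hv0 : v ≠ 0 := fun h => by rw [h] at hv; exact absurd hv (Fin.not_lt_zero r)
        obtain ⟨u, hu1, hu2, hu3⟩ := exists_interpolation (y := fun k => p k v) hinj
          (fun k l hkl => hinj (hB.eq_root_of_eq hT (hp k) (hp l) (hag k l) v hvn hv.le hkl))
        refine ⟨u, fun h => absurd h hv.asymm, fun h => absurd h hv.ne', fun _ => ⟨?_, hu2,
          fun k => ?_⟩⟩
        · simpa only [coordDegree, if_pos hv.le] using hu1
        · simpa only [homVec, if_neg hv0] using hu3 k
      · exact ⟨0, fun h => absurd h hv.asymm, fun h => absurd h hv.ne', fun h => absurd h hvn⟩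
  choose U h1 h2 h3 using main
  exact ⟨U, h1, h2 r rfl, h3⟩

/-- Points of a block which satisfy all equations identically in the root give infinitely many
partial solutions. -/
lemma infinite_of_crossRel_eq_zero (hB : TreeBlock T r n d)
    {p : Fin 8 → ℂ} (hp : IsPartialSol T n a p) {U : Fin 8 → Polynomial ℂ × Polynomial ℂ}
    (hU : ∀ v < r, U v = Prod.map Polynomial.C Polynomial.C (homVec p v))
    (hUr : U r = (Polynomial.X, 1))
    (hUp : ∀ v : Fin 8, (v : ℕ) < n → evalPair (p r) (U v) ≠ 0 ∧
      bracket (evalPair (p r) (U v)) (homVec p v) = 0)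
    (hrel : ∀ i : Fin 5, (i : ℕ) + 3 < n →
      crossRel (Polynomial.C (a i)) (fun j => U (T i j)) = 0) :
    {z | IsPartialSol T n a z}.Infinite := by
  classical
  have h3 := hB.three_le
  have hlt := hB.lt
  have h0r : (0 : Fin 8) < r := Fin.lt_def.mpr (by simp only [Fin.coe_ofNat_eq_mod]; omega)
  set E : Polynomial ℂ := ∏ v : Fin 8, ∏ w : Fin 8,
    if (v : ℕ) < n ∧ (w : ℕ) < n ∧ v ≠ w then bracket (U v) (U w) else 1 with hE
  have hE0 : E ≠ 0 := by
    refine Finset.prod_ne_zero_iff.mpr fun v _ => Finset.prod_ne_zero_iff.mpr fun w _ => ?_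
    split_ifs with h
    · intro h0
      obtain ⟨c, hc⟩ := exists_smul_of_bracket_eq_zero (homVec_ne_zero p v) (hUp v h.1).2
      obtain ⟨e, he⟩ := exists_smul_of_bracket_eq_zero (homVec_ne_zero p w) (hUp w h.2.1).2
      have hc0 : c ≠ 0 := fun h0 => (hUp v h.1).1 (by rw [hc, h0, zero_smul])
      have he0 : e ≠ 0 := fun h0 => (hUp w h.2.1).1 (by rw [he, h0, zero_smul])
      have h5 := bracket_evalPair (p r) (U v) (U w)
      rw [h0, Polynomial.eval_zero, hc, he, bracket_smul] at h5
      exact mul_ne_zero (mul_ne_zero hc0 he0) (hp.distinct v w h.1 h.2.1 h.2.2) h5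
    · exact one_ne_zero
  have hgood : {x | E.eval x ≠ 0}.Infinite :=
    (Polynomial.finite_setOfPred_isRoot hE0).infinite_compl
  let Z : ℂ → Fin 8 → ℂ := fun x v =>
    if v ≠ 0 ∧ (v : ℕ) < n then (evalPair x (U v)).1 / (evalPair x (U v)).2 else 0
  have hbr : ∀ x, E.eval x ≠ 0 → ∀ v w : Fin 8, (v : ℕ) < n → (w : ℕ) < n → v ≠ w →
      bracket (evalPair x (U v)) (evalPair x (U w)) ≠ 0 := by
    intro x hx v w hv hw hvw
    rw [hE, Polynomial.eval_prod, Finset.prod_ne_zero_iff] at hx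
    have := hx v (Finset.mem_univ v)
    rw [Polynomial.eval_prod, Finset.prod_ne_zero_iff] at this
    have := this w (Finset.mem_univ w)
    rwa [if_pos ⟨hv, hw, hvw⟩, ← bracket_evalPair] at this
  have hconst : ∀ x, ∀ v < r, evalPair x (U v) = homVec p v := fun x v hv => by
    rw [hU v hv, evalPair_C]
  have hhom : ∀ x, E.eval x ≠ 0 → ∀ v : Fin 8, (v : ℕ) < n →
      ∃ c : ℂ, c ≠ 0 ∧ homVec (Z x) v = c • evalPair x (U v) := by
    intro x hx v hv
    by_cases hv0 : v = 0
    · refine ⟨1, one_ne_zero, ?_⟩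
      rw [hv0, hconst x 0 h0r]
      simp [homVec]
    · have h2 := hbr x hx v 0 hv (by simp only [Fin.coe_ofNat_eq_mod]; omega) hv0
      rw [hconst x 0 h0r] at h2
      have h4 : (evalPair x (U v)).2 ≠ 0 := fun h => h2 (by simp [bracket, homVec, h])
      refine ⟨(evalPair x (U v)).2⁻¹, inv_ne_zero h4, ?_⟩
      simp only [homVec, if_neg hv0, Z]
      rw [if_pos ⟨hv0, hv⟩]
      ext
      · simp [div_eq_inv_mul]
      · simp [h4]
  have hlow : ∀ x, ∀ v < r, v ≠ 0 → Z x v = p v := fun x v hv hv0 => by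
    have hv' := Fin.lt_def.mp hv
    simp only [Z]
    rw [if_pos ⟨hv0, by omega⟩, hconst x v hv]
    simp [homVec, hv0]
  have hroot : ∀ x, Z x r = x := fun x => by
    simp only [Z]
    rw [if_pos ⟨h0r.ne', hlt⟩, hUr]
    simp [evalPair]
  refine Set.infinite_of_injOn_mapsTo (f := Z) (s := {x | E.eval x ≠ 0}) (fun x _ y _ hxy => ?_)
    (fun x hx => ?_) hgood
  · rw [← hroot x, ← hroot y, hxy]
  · refine ⟨by simp [Z], ?_, ?_, fun v hv => ?_, fun v w hv hw hvw => ?_, fun i hi => ?_⟩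
    · rw [hlow x 1 (Fin.lt_def.mpr (by simp only [Fin.coe_ofNat_eq_mod]; omega)) (by decide),
        hp.one]
    · rw [hlow x 2 (Fin.lt_def.mpr (by simp only [Fin.coe_ofNat_eq_mod]; omega)) (by decide),
        hp.two]
    · simp only [Z]
      rw [if_neg (by omega)]
    · obtain ⟨c, hc0, hc⟩ := hhom x hx v hv
      obtain ⟨e, he0, he⟩ := hhom x hx w hw
      rw [hc, he, bracket_smul]
      exact mul_ne_zero (mul_ne_zero hc0 he0) (hbr x hx v w hv hw hvw)
    · choose c hc0 hc using fun j => hhom x hx (T i j) (hB.lt_of_rel i hi j)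
      simp only [hc]
      rw [crossRel_smul, crossRel_evalPair, hrel i hi, Polynomial.eval_zero, mul_zero]

/-- If the number of partial solutions is finite, at most `d` of them have the same points before
a given block. -/
lemma card_le (hB : TreeBlock T r n d) (hT : ∀ i, Function.Injective (T i))
    (hfin : {z | IsPartialSol T n a z}.Finite) (S : Finset (Fin 8 → ℂ))
    (hS : ∀ z ∈ S, IsPartialSol T n a z) (hag : ∀ z ∈ S, ∀ z' ∈ S, ∀ v < r, z v = z' v) :
    S.card ≤ d := by
  classical
  have h3 := hB.three_le
  have hlt := hB.lt
  by_contra! hcard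
  have hinj : Set.InjOn (fun z : Fin 8 → ℂ => z r) S := fun z hz z' hz' h =>
    hB.eq_of_eq_root hT (hS z hz) (hS z' hz') fun v hv =>
      hv.eq_or_lt.elim (fun e => e ▸ h) (hag z hz z' hz' v)
  have hcardim : (S.image fun z => z r).card = S.card := Finset.card_image_of_injOn hinj
  obtain ⟨p₀, h0, p₁, h1, p₂, h2, h01, h02, h12⟩ :=
    Finset.two_lt_card.mp (hB.two_le.trans_lt hcard)
  let p : Fin 3 → Fin 8 → ℂ := ![p₀, p₁, p₂]
  have hpS : ∀ k, p k ∈ S := by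
    intro k; fin_cases k <;> simp [p, h0, h1, h2]
  have hpinj : Function.Injective p := by
    intro k l
    fin_cases k <;> fin_cases l <;> simp [p, h01, h02, h12, h01.symm, h02.symm, h12.symm]
  have hxinj : Function.Injective fun k => p k r := fun k l hkl =>
    hpinj (hinj (hpS k) (hpS l) hkl)
  obtain ⟨U, hU, hUr, hUn⟩ := hB.exists_interpolating_family hT (fun k => hS _ (hpS k)) hxinj
    (fun k l => hag _ (hpS k) _ (hpS l))
  have hroot : ∀ z, IsPartialSol T n a z → ∀ i : Fin 5, (i : ℕ) + 3 < n →
      (∀ v : Fin 8, (v : ℕ) < n → bracket (evalPair (z r) (U v)) (homVec z v) = 0) →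
      (crossRel (Polynomial.C (a i)) (fun j => U (T i j))).eval (z r) = 0 := by
    intro z hz i hi hzU
    choose c hc using fun j => exists_smul_of_bracket_eq_zero (homVec_ne_zero z (T i j))
      (hzU (T i j) (hB.lt_of_rel i hi j))
    rw [← crossRel_evalPair]
    simp only [hc]
    rw [crossRel_smul, hz.rel i hi, mul_zero]
  have hdeg : ∀ i : Fin 5, (i : ℕ) + 3 < n →
      (crossRel (Polynomial.C (a i)) (fun j => U (T i j))).natDegree ≤
        (Finset.univ.filter fun j => r ≤ T i j).card := by
    intro i hi
    rw [← sum_coordDegree]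
    exact natDegree_crossRel_le _ fun j => (hUn _ (hB.lt_of_rel i hi j)).1
  have htree : ∀ i : Fin 5, (i : ℕ) + 4 < n →
      crossRel (Polynomial.C (a i)) (fun j => U (T i j)) = 0 := by
    intro i hi
    refine Polynomial.eq_zero_of_natDegree_lt_card_of_eval_eq_zero _ hxinj (fun k => ?_) ?_
    · exact hroot _ (hS _ (hpS k)) i (by omega) fun v hv => (hUn v hv).2.2 k
    · have := (hdeg i (by omega)).trans (hB.card_le_two i hi)
      simp only [Fintype.card_fin]
      omega
  have hall : ∀ z ∈ S, ∀ v : Fin 8, (v : ℕ) < n →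
      bracket (evalPair (z r) (U v)) (homVec z v) = 0 := by
    intro z hz
    refine hB.bracket_eq_zero_of_root hT (hS z hz) (fun v hv => (hUn v hv).2.1 _)
      (fun i hi => ?_) (fun v hv => ?_)
    · rw [crossRel_evalPair, htree i hi, Polynomial.eval_zero]
    · rcases hv.eq_or_lt with rfl | hv
      · have hv0 : v ≠ 0 := fun h => by rw [h] at h3; simp at h3
        simp [hUr, evalPair, homVec, bracket, hv0]
      · have : homVec (p 0) v = homVec z v := by
          simp only [homVec, hag _ (hpS 0) z hz v hv]
        rw [hU v hv, this, evalPair_C, bracket_self]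
  have hrel : ∀ i : Fin 5, (i : ℕ) + 3 < n →
      crossRel (Polynomial.C (a i)) (fun j => U (T i j)) = 0 := by
    intro i hi
    rcases Nat.lt_or_ge ((i : ℕ) + 4) n with h | h
    · exact htree i h
    · refine Polynomial.eq_zero_of_natDegree_lt_card_of_eval_eq_zero' _ (S.image fun z => z r)
        (fun x hx => ?_) ?_
      · obtain ⟨z, hz, rfl⟩ := Finset.mem_image.mp hx
        exact hroot z (hS z hz) i hi (hall z hz)
      · rw [hcardim]
        exact ((hdeg i hi).trans (hB.card_closing i (by omega))).trans_lt hcard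
  exact hB.infinite_of_crossRel_eq_zero (hS _ (hpS 0)) hU hUr
    (fun v hv => ⟨(hUn v hv).2.1 _, (hUn v hv).2.2 0⟩) hrel hfin

end TreeBlock

/-- For generic `a`, there are at most `D` partial solutions with `n` points. -/
def Bound (T : Fin 5 → Fin 4 → Fin 8) (n D : ℕ) : Prop :=
  ∃ q : MvPolynomial (Fin 5) ℂ, q ≠ 0 ∧ ∀ a, MvPolynomial.eval a q ≠ 0 →
    {z | IsPartialSol T n a z}.Finite ∧ {z | IsPartialSol T n a z}.ncard ≤ D

lemma Bound.three (T : Fin 5 → Fin 4 → Fin 8) : Bound T 3 1 := by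
  refine ⟨1, one_ne_zero, fun a _ => ?_⟩
  have hsub : {z | IsPartialSol T 3 a z}.Subsingleton := by
    intro z hz z' hz'
    funext v
    by_cases hv : (v : ℕ) < 3
    · have : v = 0 ∨ v = 1 ∨ v = 2 := by omega
      rcases this with rfl | rfl | rfl
      · rw [hz.zero, hz'.zero]
      · rw [hz.one, hz'.one]
      · rw [hz.two, hz'.two]
    · rw [hz.tail v (by omega), hz'.tail v (by omega)]
  exact ⟨hsub.finite, (Set.ncard_le_one hsub.finite).mpr fun a ha b hb => hsub ha hb⟩

/-- The first `n` points of a configuration. -/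
def truncate (n : ℕ) (z : Fin 8 → ℂ) (v : Fin 8) : ℂ := if (v : ℕ) < n then z v else 0

lemma homVec_truncate {n : ℕ} {v : Fin 8} (hv : (v : ℕ) < n) (z : Fin 8 → ℂ) :
    homVec (truncate n z) v = homVec z v := by
  simp only [homVec, truncate, if_pos hv]

lemma IsPartialSol.truncate {T : Fin 5 → Fin 4 → Fin 8} {a : Fin 5 → ℂ} {z : Fin 8 → ℂ} {m n : ℕ}
    (hz : IsPartialSol T n a z) (hm : 3 ≤ m) (hmn : m ≤ n)
    (hT : ∀ i : Fin 5, (i : ℕ) + 3 < m → ∀ j, (T i j : ℕ) < m) :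
    IsPartialSol T m a (truncate m z) := by
  refine ⟨?_, ?_, ?_, fun v hv => ?_, fun v w hv hw hvw => ?_, fun i hi => ?_⟩
  · simp only [_root_.truncate, hz.zero, ite_self]
  · simp only [_root_.truncate, hz.one, ite_self]
  · rw [_root_.truncate, if_pos (by simp only [Fin.coe_ofNat_eq_mod]; omega), hz.two]
  · rw [_root_.truncate, if_neg (by omega)]
  · rw [homVec_truncate hv, homVec_truncate hw]
    exact hz.distinct v w (by omega) (by omega) hvw
  · simp only [homVec_truncate (hT i hi _)]
    exact hz.rel i (by omega)

/-- Bounding the number of solutions by the fibres of the truncation. -/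
lemma Bound.of_fibre {T : Fin 5 → Fin 4 → Fin 8} (hT : ∀ i, Function.Injective (T i))
    {m n d D : ℕ} (hm : 3 ≤ m) (hmn : m ≤ n) (hn : n ≤ 8)
    (hTm : ∀ i : Fin 5, (i : ℕ) + 3 < m → ∀ j, (T i j : ℕ) < m)
    (hTn : ∀ i : Fin 5, (i : ℕ) + 3 < n → ∀ j, (T i j : ℕ) < n)
    (hfib : ∀ a, {z | IsPartialSol T n a z}.Finite → ∀ S : Finset (Fin 8 → ℂ),
      (∀ z ∈ S, IsPartialSol T n a z) →
      (∀ z ∈ S, ∀ z' ∈ S, ∀ v : Fin 8, (v : ℕ) < m → z v = z' v) → S.card ≤ d)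
    (hB : Bound T m D) : Bound T n (D * d) := by
  classical
  obtain ⟨q, hq0, hq⟩ := hB
  obtain ⟨q', hq'0, hq'⟩ := exists_forall_finite T hT (m := n - 3) (by omega)
    (fun i hi j => by have := hTn i (by omega) j; omega)
  rw [Nat.sub_add_cancel (by omega)] at hq'
  refine ⟨q * q', mul_ne_zero hq0 hq'0, fun a ha => ?_⟩
  rw [map_mul] at ha
  obtain ⟨hfin, hcard⟩ := hq a (left_ne_zero_of_mul ha)
  have hfin' := hq' a (right_ne_zero_of_mul ha)
  refine ⟨hfin', ?_⟩
  rw [Set.ncard_eq_toFinset_card _ hfin']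
  rw [Set.ncard_eq_toFinset_card _ hfin] at hcard
  have hmaps : ∀ z ∈ hfin'.toFinset, truncate m z ∈ hfin.toFinset := fun z hz => by
    rw [Set.Finite.mem_toFinset] at hz ⊢
    exact hz.truncate hm hmn hTm
  refine (Finset.card_le_mul_card_image_of_maps_to hmaps d fun y _ => ?_).trans
    ((Nat.mul_comm _ _).trans_le (Nat.mul_le_mul_right d hcard))
  refine hfib a hfin' _ (fun z hz => ?_) (fun z hz z' hz' v hv => ?_)
  · exact hfin'.mem_toFinset.mp (Finset.mem_filter.mp hz).1
  · have h1 := congrFun (Finset.mem_filter.mp hz).2 v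
    have h2 := congrFun (Finset.mem_filter.mp hz').2 v
    simp only [truncate, if_pos hv] at h1 h2
    rw [h1, h2]

lemma Bound.treeBlock {T : Fin 5 → Fin 4 → Fin 8} (hT : ∀ i, Function.Injective (T i))
    {r : Fin 8} {n d D : ℕ} (hB : TreeBlock T r n d) (h : Bound T r D) : Bound T n (D * d) :=
  h.of_fibre hT hB.three_le hB.lt.le hB.le (fun i hi j => hB.before i hi j) hB.lt_of_rel
    fun _ hfin S hS hag => hB.card_le hT hfin S hS hag

/-- A point determined by the previous ones. -/
lemma Bound.single {T : Fin 5 → Fin 4 → Fin 8} (hT : ∀ i, Function.Injective (T i))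
    {r : Fin 8} {D : ℕ} (hr : 3 ≤ (r : ℕ))
    (hbefore : ∀ i : Fin 5, (i : ℕ) + 3 < r → ∀ j, T i j < r)
    (hrow : ∀ i : Fin 5, (i : ℕ) + 3 = r → ∃ j₀, T i j₀ = r ∧ ∀ j, j ≠ j₀ → T i j < r)
    (h : Bound T r D) : Bound T (r + 1) D := by
  have hlt : ∀ i : Fin 5, (i : ℕ) + 3 < r + 1 → ∀ j, (T i j : ℕ) < r + 1 := by
    intro i hi j
    by_cases h1 : (i : ℕ) + 3 < r
    · have := Fin.lt_def.mp (hbefore i h1 j); omega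
    · obtain ⟨j₀, e0, he⟩ := hrow i (by omega)
      by_cases h2 : j = j₀
      · rw [h2, e0]; omega
      · have := Fin.lt_def.mp (he j h2); omega
  have key := h.of_fibre (n := r + 1) (d := 1) hT hr (by omega) (by omega)
    (fun i hi j => hbefore i hi j) hlt
    fun a _ S hS hag => Finset.card_le_one.mpr fun z hz z' hz' => ?_
  · rwa [mul_one] at key
  let i : Fin 5 := ⟨r - 3, by omega⟩
  have hi : (i : ℕ) + 3 = r := by simp only [i]; omega
  obtain ⟨j₀, e0, he⟩ := hrow i hi
  have key := bracket_eq_zero_of_crossRel_of_bracket (w := fun j => homVec z' (T i j))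
    (w' := fun j => homVec z (T i j))
    (fun j k hjk => (hS z' hz').distinct _ _ (hlt i (by omega) j) (hlt i (by omega) k)
      ((hT i).ne hjk)) ((hS z' hz').rel i (by omega)) ((hS z hz).rel i (by omega)) j₀
    (fun j hj => by
      refine ⟨homVec_ne_zero _ _, ?_⟩
      have : homVec z (T i j) = homVec z' (T i j) := by
        simp only [homVec, hag z hz z' hz' _ (Fin.lt_def.mp (he j hj))]
      rw [this, bracket_self])
  rw [e0] at key
  funext v
  rcases lt_trichotomy (v : ℕ) r with hv | hv | hv
  · exact hag z hz z' hz' v hv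
  · rw [Fin.ext hv]
    exact eq_of_bracket_homVec_eq_zero (fun h0 => by rw [h0] at hr; simp at hr) key
  · rw [(hS z hz).tail v (by omega), (hS z' hz').tail v (by omega)]

lemma Bound.of_overdetermined {T : Fin 5 → Fin 4 → Fin 8} (hT : ∀ i, Function.Injective (T i))
    {m : ℕ} (ρ : Fin (m + 1) → Fin 5) (hinj : Function.Injective ρ)
    (hρ : ∀ i j, (T (ρ i) j : ℕ) < m + 3) : Bound T 8 0 := by
  have hm := Fintype.card_le_of_injective ρ hinj
  simp only [Fintype.card_fin] at hm
  obtain ⟨q, hq0, hq⟩ := exists_forall_not_isPartialSol T hT (by omega) ρ hinj hρ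
  refine ⟨q, hq0, fun a ha => ?_⟩
  have : {z | IsPartialSol T 8 a z} = ∅ := Set.eq_empty_of_forall_notMem fun z => hq a ha z
  simp [this]

/-- Homogeneous coordinates of a point of `ℙ¹(ℂ)`. -/
def pointVec : OnePoint ℂ → ℂ × ℂ
  | Option.none => (1, 0)
  | Option.some x => (x, 1)

lemma bracket_pointVec_ne_zero {x y : OnePoint ℂ} (h : x ≠ y) :
    bracket (pointVec x) (pointVec y) ≠ 0 := by
  intro h0
  rcases x with _ | x <;> rcases y with _ | y <;> simp only [pointVec, bracket] at h0
  · exact h rfl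
  · simp at h0
  · simp at h0
  · exact h (congrArg Option.some (by linear_combination h0))

lemma crossRel_pointVec {x : Fin 4 → OnePoint ℂ} (hx : Function.Injective x) {a : ℂ}
    (h : CR (x 0) (x 1) (x 2) (x 3) = a) : crossRel a (fun j => pointVec (x j)) = 0 := by
  have h01 : x 0 ≠ x 1 := hx.ne (by decide)
  have h02 : x 0 ≠ x 2 := hx.ne (by decide)
  have h03 : x 0 ≠ x 3 := hx.ne (by decide)
  have h12 : x 1 ≠ x 2 := hx.ne (by decide)
  have h13 : x 1 ≠ x 3 := hx.ne (by decide)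
  have h23 : x 2 ≠ x 3 := hx.ne (by decide)
  have hsub : ∀ u v : ℂ, (Option.some u : OnePoint ℂ) ≠ Option.some v → v - u ≠ 0 :=
    fun u v huv h0 => huv (congrArg Option.some (by linear_combination -h0))
  unfold crossRel
  beta_reduce
  generalize x 0 = y₀ at *
  generalize x 1 = y₁ at *
  generalize x 2 = y₂ at *
  generalize x 3 = y₃ at *
  subst h
  rcases y₀ with _ | y₀ <;> rcases y₁ with _ | y₁ <;> rcases y₂ with _ | y₂ <;>
    rcases y₃ with _ | y₃ <;>
    first
      | exact absurd rfl h01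
      | exact absurd rfl h02
      | exact absurd rfl h03
      | exact absurd rfl h12
      | exact absurd rfl h13
      | exact absurd rfl h23
      | skip
  · have := hsub _ _ h12
    simp only [CR, pointVec, bracket]; field_simp; ring
  · have := hsub _ _ h03
    simp only [CR, pointVec, bracket]; field_simp; ring
  · have := hsub _ _ h03
    simp only [CR, pointVec, bracket]; field_simp; ring
  · have := hsub _ _ h12
    simp only [CR, pointVec, bracket]; field_simp; ring
  · have := hsub _ _ h12
    have := hsub _ _ h03
    simp only [CR, pointVec, bracket]; field_simp; ring

/-- The affine coordinate in which the points with indices `0, 1, 2` are `∞, 0, 1`. -/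
noncomputable def affineCoord (Q : Fin 8 → ℂ × ℂ) (v : Fin 8) : ℂ :=
  if v = 0 then 0 else
    bracket (Q v) (Q 1) * bracket (Q 2) (Q 0) / (bracket (Q v) (Q 0) * bracket (Q 2) (Q 1))

lemma bracket_homVec_zero_left (z : Fin 8 → ℂ) {w : Fin 8} (hw : w ≠ 0) :
    bracket (homVec z 0) (homVec z w) = 1 := by
  simp [homVec, hw, bracket]

lemma bracket_homVec_zero_right (z : Fin 8 → ℂ) {v : Fin 8} (hv : v ≠ 0) :
    bracket (homVec z v) (homVec z 0) = -1 := by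
  simp [homVec, hv, bracket]

lemma bracket_homVec_of_ne_zero (z : Fin 8 → ℂ) {v w : Fin 8} (hv : v ≠ 0) (hw : w ≠ 0) :
    bracket (homVec z v) (homVec z w) = z v - z w := by
  simp [homVec, hv, hw, bracket]

lemma bracket_homVec_affineCoord {Q : Fin 8 → ℂ × ℂ}
    (hQ : ∀ v w, v ≠ w → bracket (Q v) (Q w) ≠ 0) :
    ∃ (κ : ℂ) (c : Fin 8 → ℂ), κ ≠ 0 ∧ (∀ v, c v ≠ 0) ∧ ∀ v w,
      bracket (homVec (affineCoord Q) v) (homVec (affineCoord Q) w) =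
        κ * (c v * c w) * bracket (Q v) (Q w) := by
  have h20 := hQ 2 0 (by decide)
  have h21 := hQ 2 1 (by decide)
  have h10 := hQ 1 0 (by decide)
  set κ := bracket (Q 2) (Q 0) * bracket (Q 1) (Q 0) / bracket (Q 2) (Q 1) with hκ
  have hκ0 : κ ≠ 0 := div_ne_zero (mul_ne_zero h20 h10) h21
  refine ⟨κ, fun v => if v = 0 then -κ⁻¹ else (bracket (Q v) (Q 0))⁻¹, hκ0, fun v => ?_,
    fun v w => ?_⟩
  · beta_reduce
    split_ifs with h
    · exact neg_ne_zero.mpr (inv_ne_zero hκ0)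
    · exact inv_ne_zero (hQ v 0 h)
  · beta_reduce
    have hcomm : bracket (Q 0) (Q w) = - bracket (Q w) (Q 0) := by simp only [bracket]; ring
    by_cases hv : v = 0 <;> by_cases hw : w = 0
    · rw [hv, hw, bracket_self, bracket_self, mul_zero]
    · have hw0 := hQ w 0 hw
      rw [hv, if_pos rfl, if_neg hw, hcomm, bracket_homVec_zero_left _ hw]
      field_simp
    · have hv0 := hQ v 0 hv
      rw [hw, if_pos rfl, if_neg hv, bracket_homVec_zero_right _ hv]
      field_simp
    · have hv0 := hQ v 0 hv
      have hw0 := hQ w 0 hw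
      have hpl : bracket (Q v) (Q 1) * bracket (Q w) (Q 0) -
          bracket (Q w) (Q 1) * bracket (Q v) (Q 0) =
          bracket (Q v) (Q w) * bracket (Q 1) (Q 0) := by simp only [bracket]; ring
      rw [if_neg hv, if_neg hw, bracket_homVec_of_ne_zero _ hv hw, hκ, affineCoord, if_neg hv,
        affineCoord, if_neg hw]
      field_simp
      linear_combination hpl

lemma affineCoord_congr {Q R : Fin 8 → ℂ × ℂ} (hQ : ∀ v w, v ≠ w → bracket (Q v) (Q w) ≠ 0)
    {κ : ℂ} {c : Fin 8 → ℂ} (hκ : κ ≠ 0) (hc : ∀ v, c v ≠ 0)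
    (h : ∀ v w, bracket (R v) (R w) = κ * (c v * c w) * bracket (Q v) (Q w)) :
    affineCoord R = affineCoord Q := by
  funext v
  unfold affineCoord
  split_ifs with hv
  · rfl
  · have h21 := hQ 2 1 (by decide)
    have hv0 := hQ v 0 hv
    have := hc 0
    have := hc 1
    have := hc 2
    have := hc v
    simp only [h]
    field_simp

lemma crossRel_congr {a κ : ℂ} {w w' : Fin 4 → ℂ × ℂ} {c : Fin 4 → ℂ}
    (h : ∀ i j, bracket (w' i) (w' j) = κ * (c i * c j) * bracket (w i) (w j)) :
    crossRel a w' = κ ^ 2 * (c 0 * c 1 * c 2 * c 3) * crossRel a w := by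
  simp only [crossRel, h]; ring

/-- Up to relabelling, generically at most four configurations. -/
def FourBounded (T : Fin 5 → Fin 4 → Fin 8) : Prop :=
  ∃ (σ : Equiv.Perm (Fin 8)) (τ : Equiv.Perm (Fin 5)), ∃ D ≤ 4,
    Bound (fun i j => σ (T (τ i) j)) 8 D

lemma pointVec_affineCoord {p : Fin 8 → OnePoint ℂ} (hp : Function.Injective p) (h0 : p 0 = ∞)
    (h1 : p 1 = ((0 : ℂ) : OnePoint ℂ)) (h2 : p 2 = ((1 : ℂ) : OnePoint ℂ)) {v : Fin 8}
    (hv : v ≠ 0) : p v = ((affineCoord (fun v => pointVec (p v)) v : ℂ) : OnePoint ℂ) := by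
  have hpv : p v ≠ ∞ := fun h => hv (hp (h.trans h0.symm))
  obtain ⟨x, hx⟩ := OnePoint.ne_infty_iff_exists.mp hpv
  have hq : ∀ y : ℂ, pointVec (y : OnePoint ℂ) = (y, 1) := fun _ => rfl
  have hi : pointVec ∞ = (1, 0) := rfl
  rw [← hx]
  congr 1
  simp only [affineCoord, if_neg hv, ← hx, h0, h1, h2, hq, hi, bracket]
  simp

lemma FourBounded.exists_polynomial {T : Fin 5 → Fin 4 → Fin 8}
    (hT : ∀ i, Function.Injective (T i)) (h : FourBounded T) :
    ∃ q : MvPolynomial (Fin 5) ℂ, q ≠ 0 ∧ ∀ a : Fin 5 → ℂ, MvPolynomial.eval a q ≠ 0 →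
      {p : Fin 8 → OnePoint ℂ | Function.Injective p ∧ p 0 = ∞ ∧ p 1 = ((0 : ℂ) : OnePoint ℂ) ∧
        p 2 = ((1 : ℂ) : OnePoint ℂ) ∧
        ∀ i, CR (p (T i 0)) (p (T i 1)) (p (T i 2)) (p (T i 3)) = a i}.Finite ∧
      {p : Fin 8 → OnePoint ℂ | Function.Injective p ∧ p 0 = ∞ ∧ p 1 = ((0 : ℂ) : OnePoint ℂ) ∧
        p 2 = ((1 : ℂ) : OnePoint ℂ) ∧
        ∀ i, CR (p (T i 0)) (p (T i 1)) (p (T i 2)) (p (T i 3)) = a i}.ncard ≤ 4 := by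
  obtain ⟨σ, τ, D, hD, q, hq0, hq⟩ := h
  refine ⟨MvPolynomial.rename τ q, fun h => hq0 ?_, fun a ha => ?_⟩
  · exact (map_eq_zero_iff _ (MvPolynomial.rename_injective _ τ.injective)).mp h
  rw [MvPolynomial.eval_rename] at ha
  obtain ⟨hfin, hcard⟩ := hq (a ∘ τ) ha
  let Φ : (Fin 8 → OnePoint ℂ) → Fin 8 → ℂ := fun p =>
    affineCoord fun v => pointVec (p (σ.symm v))
  have hbr : ∀ {p : Fin 8 → OnePoint ℂ}, Function.Injective p → ∀ v w, v ≠ w →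
      bracket (pointVec (p v)) (pointVec (p w)) ≠ 0 := fun hp v w hvw =>
    bracket_pointVec_ne_zero (hp.ne hvw)
  have hΦ : ∀ p : Fin 8 → OnePoint ℂ, Function.Injective p →
      ∃ (κ : ℂ) (c : Fin 8 → ℂ), κ ≠ 0 ∧ (∀ v, c v ≠ 0) ∧ ∀ v w,
        bracket (homVec (Φ p) (σ v)) (homVec (Φ p) (σ w)) =
          κ * (c v * c w) * bracket (pointVec (p v)) (pointVec (p w)) := by
    intro p hp
    obtain ⟨κ, c, hκ, hc, hb⟩ := bracket_homVec_affineCoord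
      (Q := fun v => pointVec (p (σ.symm v))) (fun v w hvw => hbr hp _ _ (σ.symm.injective.ne hvw))
    exact ⟨κ, fun v => c (σ v), hκ, fun v => hc _, fun v w => by simpa using hb (σ v) (σ w)⟩
  have hcoord : ∀ p : Fin 8 → OnePoint ℂ, Function.Injective p →
      affineCoord (fun v => homVec (Φ p) (σ v)) = affineCoord (fun v => pointVec (p v)) := by
    intro p hp
    obtain ⟨κ, c, hκ, hc, hb⟩ := hΦ p hp
    exact affineCoord_congr (hbr hp) hκ hc hb
  set S := {p : Fin 8 → OnePoint ℂ | Function.Injective p ∧ p 0 = ∞ ∧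
    p 1 = ((0 : ℂ) : OnePoint ℂ) ∧ p 2 = ((1 : ℂ) : OnePoint ℂ) ∧
    ∀ i, CR (p (T i 0)) (p (T i 1)) (p (T i 2)) (p (T i 3)) = a i} with hS
  have hmaps : ∀ p ∈ S, Φ p ∈ {z | IsPartialSol (fun i j => σ (T (τ i) j)) 8 (a ∘ τ) z} := by
    rintro p ⟨hp, -, -, -, hrel⟩
    obtain ⟨κ, c, hκ, hc, hb⟩ := hΦ p hp
    have hσ : ∀ v w, v ≠ w → bracket (pointVec (p (σ.symm v))) (pointVec (p (σ.symm w))) ≠ 0 :=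
      fun v w hvw => hbr hp _ _ (σ.symm.injective.ne hvw)
    refine ⟨?_, ?_, ?_, fun v hv => by omega, fun v w _ _ hvw => ?_, fun i _ => ?_⟩
    · simp [Φ, affineCoord]
    · simp [Φ, affineCoord, bracket_self]
    · have h20 := hσ 2 0 (by decide)
      have h21 := hσ 2 1 (by decide)
      simp only [Φ, affineCoord]
      rw [if_neg (by decide), mul_comm, div_self (mul_ne_zero h20 h21)]
    · have := hb (σ.symm v) (σ.symm w)
      rw [σ.apply_symm_apply, σ.apply_symm_apply] at this
      rw [this]
      exact mul_ne_zero (mul_ne_zero hκ (mul_ne_zero (hc _) (hc _))) (hσ v w hvw)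
    · rw [crossRel_congr (w := fun j => pointVec (p (T (τ i) j))) (κ := κ)
        (c := fun j => c (T (τ i) j)) (fun j k => hb _ _), Function.comp_apply,
        crossRel_pointVec (x := fun j => p (T (τ i) j)) (hp.comp (hT _)) (hrel (τ i)), mul_zero]
  have hinj : Set.InjOn Φ S := by
    rintro p ⟨hp, h0, h1, h2, -⟩ p' ⟨hp', h0', h1', h2', -⟩ hpp
    funext v
    by_cases hv : v = 0
    · rw [hv, h0, h0']
    · rw [pointVec_affineCoord hp h0 h1 h2 hv, pointVec_affineCoord hp' h0' h1' h2' hv,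
        ← hcoord p hp, ← hcoord p' hp', hpp]
  exact ⟨Set.Finite.of_injOn hmaps hinj hfin,
    (Set.ncard_le_ncard_of_injOn Φ hmaps hinj hfin).trans (hcard.trans hD)⟩

/-- The set of indices in `e`, as a bit mask. -/
def rowMask (e : Fin 4 → Fin 8) : ℕ :=
  2 ^ (e 0 : ℕ) ||| 2 ^ (e 1 : ℕ) ||| 2 ^ (e 2 : ℕ) ||| 2 ^ (e 3 : ℕ)

lemma testBit_rowMask (e : Fin 4 → Fin 8) (v : ℕ) :
    (rowMask e).testBit v = true ↔ ∃ j, (e j : ℕ) = v := by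
  simp only [rowMask, Nat.testBit_or, Nat.testBit_two_pow, Bool.or_eq_true, decide_eq_true_eq]
  constructor
  · rintro (((h | h) | h) | h)
    exacts [⟨0, h⟩, ⟨1, h⟩, ⟨2, h⟩, ⟨3, h⟩]
  · rintro ⟨j, h⟩
    fin_cases j <;> simp_all

/-- `Nat.testBit`, in a form that the kernel evaluates quickly. -/
def hasBit (m v : ℕ) : Bool := Nat.beq (Nat.mod (Nat.shiftRight m v) 2) 1

lemma hasBit_eq_testBit (m v : ℕ) : hasBit m v = m.testBit v := by
  rw [Bool.eq_iff_iff, hasBit, Nat.beq_eq, Nat.testBit_eq_decide_div_mod_eq, decide_eq_true_eq,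
    ← Nat.shiftRight_eq_div_pow]
  rfl

/-- `f m`, with `m` evaluated first. -/
def evalFirst {α : Type} (f : ℕ → α) : ℕ → α
  | 0 => f 0
  | k + 1 => f (Nat.succ k)

lemma evalFirst_eq {α : Type} (f : ℕ → α) (m : ℕ) : evalFirst f m = f m := by
  cases m <;> rfl

/-- The number of elements `≥ n` of a subset of `{0, …, 7}` given as a bit mask. -/
def countFrom (n m : ℕ) : ℕ := evalFirst (fun m =>
  [0, 1, 2, 3, 4, 5, 6, 7].foldl (fun k v => bif Nat.ble n v && hasBit m v then Nat.succ k else k) 0) m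

lemma countFrom_eq_card (n m : ℕ) :
    countFrom n m = ((Finset.range 8).filter fun v => n ≤ v ∧ m.testBit v).card := by
  have key : ∀ (l : List ℕ) (k : ℕ),
      l.foldl (fun k v => bif Nat.ble n v && m.testBit v then Nat.succ k else k) k =
        k + l.countP fun v => decide (n ≤ v ∧ m.testBit v) := by
    intro l
    induction l with
    | nil => simp
    | cons x l ih =>
      intro k
      rw [List.foldl_cons, ih, List.countP_cons]
      have hx : (Nat.ble n x && m.testBit x) = decide (n ≤ x ∧ m.testBit x) := by
        rw [Bool.eq_iff_iff]
        simp
      rw [hx]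
      cases decide (n ≤ x ∧ m.testBit x)
      · simp
      · simp only [cond_true, if_true]
        omega
  simp only [countFrom, evalFirst_eq, hasBit_eq_testBit]
  rw [key, zero_add, List.countP_eq_length_filter]
  rfl

lemma countFrom_rowMask {e : Fin 4 → Fin 8} (he : Function.Injective e) (n : ℕ) :
    countFrom n (rowMask e) = (Finset.univ.filter fun j => n ≤ (e j : ℕ)).card := by
  rw [countFrom_eq_card, ← Finset.card_image_of_injective _ (Fin.val_injective.comp he)]
  congr 1
  ext v
  simp only [Finset.mem_filter, Finset.mem_range, testBit_rowMask, Finset.mem_image,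
    Finset.mem_univ, true_and, Function.comp_apply]
  constructor
  · rintro ⟨-, hn, j, rfl⟩
    exact ⟨j, hn, rfl⟩
  · rintro ⟨j, hn, rfl⟩
    exact ⟨(e j).isLt, hn, j, rfl⟩

lemma rowMask_shiftRight_eq_one {e : Fin 4 → Fin 8} (he : Function.Injective e) {n : ℕ}
    (h : rowMask e >>> n = 1) : ∃ j₀, (e j₀ : ℕ) = n ∧ ∀ j, j ≠ j₀ → (e j : ℕ) < n := by
  have hbit : ∀ k, (rowMask e).testBit (n + k) = true ↔ k = 0 := fun k => by
    rw [← Nat.testBit_shiftRight, h, Nat.testBit_one_eq_true_iff_self_eq_zero]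
  obtain ⟨j₀, h0⟩ := (testBit_rowMask e _).mp ((hbit 0).mpr rfl)
  refine ⟨j₀, h0, fun j hj => ?_⟩
  by_contra! hn
  have := (hbit (e j - n)).mp ((testBit_rowMask e _).mpr ⟨j, by omega⟩)
  exact hj (he (Fin.ext (by omega)))

lemma rowMask_lt {e : Fin 4 → Fin 8} {n : ℕ} (h : rowMask e >>> n = 0) (j : Fin 4) :
    (e j : ℕ) < n := by
  by_contra! hn
  have := (testBit_rowMask e (n + (e j - n))).mpr ⟨j, by omega⟩
  rw [← Nat.testBit_shiftRight, h] at this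
  simp at this

/-- The image of the index `v` under the relabelling with decimal digits `w`. -/
def digit (w v : ℕ) : ℕ := Nat.mod (Nat.div w (Nat.pow 10 v)) 10

/-- The image of a bit mask under the relabelling with decimal digits `w`. -/
def relabel (w m : ℕ) : ℕ :=
  evalFirst (fun m => [0, 1, 2, 3, 4, 5, 6, 7].foldl
    (fun b v => bif hasBit m v then Nat.lor b (Nat.pow 2 (digit w v)) else b) 0) m

lemma testBit_relabel (w m u : ℕ) :
    (relabel w m).testBit u = true ↔ ∃ v < 8, m.testBit v = true ∧ digit w v = u := by
  have key : ∀ (l : List ℕ) (b : ℕ), (l.foldl (fun b v =>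
      bif m.testBit v then Nat.lor b (Nat.pow 2 (digit w v)) else b) b).testBit u = true ↔
      b.testBit u = true ∨ ∃ v ∈ l, m.testBit v = true ∧ digit w v = u := by
    intro l
    induction l with
    | nil => simp
    | cons x l ih =>
      intro b
      rw [List.foldl_cons, ih]
      cases hx : m.testBit x <;> simp [hx, Nat.testBit_two_pow, or_assoc]
  have hrange : ∀ v, v ∈ [0, 1, 2, 3, 4, 5, 6, 7] ↔ v < 8 := fun v => by
    rw [show [0, 1, 2, 3, 4, 5, 6, 7] = List.range 8 from rfl, List.mem_range]
  simp only [relabel, evalFirst_eq, hasBit_eq_testBit, key, hrange]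
  simp

lemma exists_perm_of_relabel {w : ℕ} (h : relabel w 255 = 255) :
    ∃ σ : Equiv.Perm (Fin 8), ∀ e, rowMask (fun j => σ (e j)) = relabel w (rowMask e) := by
  have h255 : ∀ v, Nat.testBit 255 v = true ↔ v < 8 := fun v => by
    rw [show 255 = 2 ^ 8 - 1 from rfl, Nat.testBit_two_pow_sub_one, decide_eq_true_eq]
  have hlt : ∀ v : Fin 8, digit w v < 8 := fun v => by
    rw [← h255, ← h, testBit_relabel]
    exact ⟨v, v.isLt, (h255 v).mpr v.isLt, rfl⟩
  let f : Fin 8 → Fin 8 := fun v => ⟨digit w v, hlt v⟩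
  have hf : Function.Surjective f := fun u => by
    have hu := (h255 u).mpr u.isLt
    rw [← h, testBit_relabel] at hu
    obtain ⟨v, hv, -, hvu⟩ := hu
    exact ⟨⟨v, hv⟩, Fin.ext hvu⟩
  refine ⟨Equiv.ofBijective f hf.bijective_of_finite, fun e => Nat.eq_of_testBit_eq fun u => ?_⟩
  rw [Bool.eq_iff_iff, testBit_rowMask, testBit_relabel]
  constructor
  · rintro ⟨j, hj⟩
    exact ⟨e j, (e j).isLt, (testBit_rowMask _ _).mpr ⟨j, rfl⟩, hj⟩
  · rintro ⟨v, -, hv, hu⟩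
    obtain ⟨j, rfl⟩ := (testBit_rowMask _ _).mp hv
    exact ⟨j, hu⟩

lemma exists_perm_of_ofFn_perm {n : ℕ} {f g : Fin n → ℕ} (h : (List.ofFn g).Perm (List.ofFn f)) :
    ∃ τ : Equiv.Perm (Fin n), ∀ i, f (τ i) = g i := by
  have h1 : (List.ofFn (g ∘ Tuple.sort g)).Perm (List.ofFn (f ∘ Tuple.sort f)) :=
    ((Equiv.Perm.ofFn_comp_perm _ g).trans h).trans (Equiv.Perm.ofFn_comp_perm _ f).symm
  have h2 : g ∘ Tuple.sort g = f ∘ Tuple.sort f := List.ofFn_injective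
    (h1.eq_of_sortedLE (Tuple.monotone_sort g).sortedLE_ofFn (Tuple.monotone_sort f).sortedLE_ofFn)
  refine ⟨(Tuple.sort g).symm.trans (Tuple.sort f), fun i => ?_⟩
  have := congrFun h2 ((Tuple.sort g).symm i)
  simpa using this.symm

/-- All data whose index sets are those in `l` are four-bounded. -/
def MasksBounded (l : List ℕ) : Prop :=
  ∀ T : Fin 5 → Fin 4 → Fin 8, (∀ i, Function.Injective (T i)) →
    l.Perm (List.ofFn fun i => rowMask (T i)) → FourBounded T

lemma MasksBounded.perm {l l' : List ℕ} (h : MasksBounded l) (hl : l'.Perm l) : MasksBounded l' :=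
  fun T hT hp => h T hT (hl.symm.trans hp)

lemma MasksBounded.of_relabel {w : ℕ} (hw : relabel w 255 = 255) {l : List ℕ}
    (h : MasksBounded (l.map (relabel w))) : MasksBounded l := by
  obtain ⟨σ, hσ⟩ := exists_perm_of_relabel hw
  intro T hT hp
  obtain ⟨σ', τ, D, hD, hB⟩ := h (fun i j => σ (T i j)) (fun i => σ.injective.comp (hT i)) (by
    have := hp.map (relabel w)
    rw [List.map_ofFn] at this
    simpa only [hσ, Function.comp_def] using this)
  exact ⟨σ.trans σ', τ, D, hD, hB⟩

lemma MasksBounded.of_forall {l : List ℕ} (hl : l.length = 5)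
    (h : ∀ T : Fin 5 → Fin 4 → Fin 8, (∀ i, Function.Injective (T i)) →
      (∀ i : Fin 5, rowMask (T i) = l.getD i 0) → FourBounded T) : MasksBounded l := by
  intro T hT hp
  obtain ⟨τ, hτ⟩ := exists_perm_of_ofFn_perm (g := fun i : Fin 5 => l.getD i 0)
    (f := fun i => rowMask (T i)) (by
      convert hp
      refine List.ext_getElem (by simp [hl]) fun i h1 h2 => ?_
      rw [List.getElem_ofFn, List.getD_eq_getElem _ 0 h2])
  obtain ⟨σ, τ', D, hD, hB⟩ := h (fun i => T (τ i)) (fun i => hT _) hτ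
  exact ⟨σ, τ'.trans τ, D, hD, hB⟩

lemma exists_perm_lt {W : Finset (Fin 8)} {n : ℕ} (hW : W.card ≤ n) :
    ∃ σ : Equiv.Perm (Fin 8), ∀ v ∈ W, (σ v : ℕ) < n := by
  have hcard : Fintype.card {v // v ∈ W} = Fintype.card {v : Fin 8 // (v : ℕ) < W.card} := by
    have h8 := Finset.card_le_univ W
    rw [Fintype.card_fin] at h8
    rw [Fintype.card_coe, Fintype.card_subtype, Fin.card_filter_val_lt, min_eq_right h8]
  let e := Fintype.equivOfCardEq hcard
  refine ⟨e.extendSubtype, fun v hv => ?_⟩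
  rw [Equiv.extendSubtype_apply_of_mem e v hv]
  exact (e ⟨v, hv⟩).2.trans_le hW

/-- Some `k ≥ 1` of the masks have at most `k + 2` elements in total; `m` and `k` collect the
masks already chosen. -/
def overdetermined : List ℕ → ℕ → ℕ → Bool
  | [], m, k => Nat.ble 1 k && Nat.ble (countFrom 0 m) (Nat.add k 2)
  | x :: l, m, k =>
    evalFirst (fun m => overdetermined l m (Nat.succ k)) (Nat.lor m x) || overdetermined l m k

lemma exists_sublist_of_overdetermined {l : List ℕ} {m k : ℕ}
    (h : overdetermined l m k = true) : ∃ R : List ℕ, R.Sublist l ∧ 1 ≤ k + R.length ∧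
      countFrom 0 (R.foldl (· ||| ·) m) ≤ k + R.length + 2 := by
  induction l generalizing m k with
  | nil =>
    simp only [overdetermined, Bool.and_eq_true, Nat.ble_eq] at h
    exact ⟨[], List.Sublist.refl _, by simpa using h.1, by simpa using h.2⟩
  | cons x l ih =>
    simp only [overdetermined, evalFirst_eq, Bool.or_eq_true] at h
    rcases h with h | h
    · obtain ⟨R, h1, h2, h3⟩ := ih h
      exact ⟨x :: R, h1.cons_cons x, by rw [List.length_cons]; omega, by
        rw [List.length_cons]; exact h3.trans (by omega)⟩
    · obtain ⟨R, h1, h2, h3⟩ := ih h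
      exact ⟨R, h1.cons x, h2, h3⟩

lemma testBit_foldl_or (R : List ℕ) (m v : ℕ) :
    (R.foldl (· ||| ·) m).testBit v = true ↔ m.testBit v = true ∨ ∃ x ∈ R, x.testBit v = true := by
  induction R generalizing m with
  | nil => simp
  | cons x R ih => simp [ih, Nat.testBit_or, or_assoc]

lemma MasksBounded.of_overdetermined {l : List ℕ} (h : overdetermined l 0 0 = true)
    (l' : List ℕ) (hl : (l ++ l').length = 5) : MasksBounded (l ++ l') := by
  obtain ⟨R, hRl, hR1, hR2⟩ := exists_sublist_of_overdetermined h
  obtain ⟨R', hR'⟩ := hRl.exists_perm_append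
  rw [zero_add] at hR1 hR2
  have hperm : (l ++ l').Perm (R ++ (R' ++ l')) := by
    rw [← List.append_assoc]; exact hR'.append_right l'
  refine MasksBounded.perm (.of_forall (hperm.length_eq ▸ hl) fun T hT hTl => ?_) hperm
  have hlen : R.length ≤ 5 := by
    have := hperm.length_eq
    rw [hl, List.length_append] at this
    omega
  let W : Finset (Fin 8) :=
    Finset.univ.filter fun v => (R.foldl (· ||| ·) 0).testBit v = true
  have hW : W.card ≤ R.length + 2 := by
    refine le_trans (le_of_eq ?_) hR2
    rw [countFrom_eq_card, ← Finset.card_image_of_injective _ Fin.val_injective]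
    congr 1
    ext v
    simp only [W, Finset.mem_image, Finset.mem_filter, Finset.mem_univ, true_and,
      Finset.mem_range, Nat.zero_le]
    constructor
    · rintro ⟨u, hu, rfl⟩
      exact ⟨u.isLt, hu⟩
    · rintro ⟨hv, hu⟩
      exact ⟨⟨v, hv⟩, hu, rfl⟩
  obtain ⟨σ, hσ⟩ := exists_perm_lt hW
  refine ⟨σ, 1, 0, by omega, ?_⟩
  refine Bound.of_overdetermined (fun i => σ.injective.comp (hT i)) (m := R.length - 1)
    (Fin.castLE (by omega)) (Fin.castLE_injective _) fun i j => ?_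
  have hi : (i : ℕ) < R.length := by omega
  have : (σ (T (Fin.castLE (by omega) i) j) : ℕ) < R.length + 2 := by
    refine hσ _ (Finset.mem_filter.mpr ⟨Finset.mem_univ _, ?_⟩)
    rw [testBit_foldl_or]
    refine Or.inr ⟨R[(i : ℕ)], List.getElem_mem hi, ?_⟩
    have h1 := hTl (Fin.castLE (by omega) i)
    rw [Fin.val_castLE, List.getD_eq_getElem?_getD, List.getElem?_append_left hi,
      List.getElem?_eq_getElem hi, Option.getD_some] at h1
    rw [← h1, testBit_rowMask]
    exact ⟨j, rfl⟩
  simp only [Equiv.Perm.one_apply]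
  omega

/-- Whether the index sets `R` allow to place the points in successive blocks of the given sizes,
with `n` points and at most `D` solutions at the start, and at most four solutions at the end. -/
def checkBlocks (R : List ℕ) : List ℕ → ℕ → ℕ → Bool
  | [], n, D => Nat.beq n 8 && Nat.ble D 4
  | 0 :: _, _, _ => false
  | 1 :: L, n, D =>
    Nat.ble n 7 && Nat.beq (R.getD (n - 3) 0 >>> n) 1 && checkBlocks R L (n + 1) D
  | (k + 2) :: L, n, D =>
    Nat.ble (n + k + 2) 8 &&
    ((List.range (k + 1)).all fun x => Nat.beq (R.getD (n - 3 + x) 0 >>> (n + x + 1)) 1 &&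
      Nat.beq (countFrom n (R.getD (n - 3 + x) 0)) 2) &&
    Nat.beq (R.getD (n + k - 2) 0 >>> (n + k + 2)) 0 &&
    checkBlocks R L (n + k + 2) (D * max 2 (countFrom n (R.getD (n + k - 2) 0)))

lemma treeBlock_of_masks {T : Fin 5 → Fin 4 → Fin 8} (hT : ∀ i, Function.Injective (T i))
    {R : List ℕ} (hR : ∀ i : Fin 5, rowMask (T i) = R.getD i 0) {r : Fin 8} {k : ℕ}
    (hr : 3 ≤ (r : ℕ)) (hk : (r : ℕ) + k + 2 ≤ 8)
    (hbefore : ∀ i : Fin 5, (i : ℕ) + 3 < r → ∀ j, T i j < r)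
    (htree : ∀ x < k + 1, R.getD (r - 3 + x) 0 >>> ((r : ℕ) + x + 1) = 1 ∧
      countFrom r (R.getD (r - 3 + x) 0) = 2)
    (hclosing : R.getD (r + k - 2) 0 >>> ((r : ℕ) + k + 2) = 0) :
    TreeBlock T r (r + k + 2) (max 2 (countFrom r (R.getD (r + k - 2) 0))) where
  three_le := hr
  lt := by omega
  le := hk
  before := hbefore
  tree i v hv hvn hi := by
    have hv' := Fin.lt_def.mp hv
    obtain ⟨h1, h2⟩ := htree (v - r - 1) (by omega)
    rw [show (r : ℕ) - 3 + (v - r - 1) = i by omega, ← hR] at h1 h2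
    rw [show (r : ℕ) + (v - r - 1) + 1 = v by omega] at h1
    obtain ⟨j₀, hj₀, hlt⟩ := rowMask_shiftRight_eq_one (hT i) h1
    rw [countFrom_rowMask (hT i), Finset.card_eq_two] at h2
    obtain ⟨x, y, hxy, hs⟩ := h2
    have hmem : ∀ j, r ≤ T i j ↔ j = x ∨ j = y := fun j => by
      have := Finset.ext_iff.mp hs j
      simpa using this
    have hrj₀ : r ≤ T i j₀ := by rw [Fin.le_def, hj₀]; omega
    obtain ⟨j₁, hne, hj₁, hall⟩ : ∃ j₁, j₀ ≠ j₁ ∧ r ≤ T i j₁ ∧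
        ∀ j, j ≠ j₀ → j ≠ j₁ → T i j < r := by
      rcases (hmem j₀).mp hrj₀ with rfl | rfl
      · exact ⟨y, hxy, (hmem y).mpr (.inr rfl), fun j h h' => by
          rw [← not_le, hmem]; tauto⟩
      · exact ⟨x, hxy.symm, (hmem x).mpr (.inl rfl), fun j h h' => by
          rw [← not_le, hmem]; tauto⟩
    exact ⟨j₀, j₁, hne, Fin.ext hj₀, hj₁, hlt j₁ hne.symm, hall⟩
  closing i hi j := by
    refine rowMask_lt ?_ j
    rwa [hR, show (i : ℕ) = r + k - 2 by omega]
  card_closing i hi := by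
    refine le_trans (le_of_eq ?_) (le_max_right _ _)
    rw [show (r : ℕ) + k - 2 = i by omega, ← hR, countFrom_rowMask (hT i)]
    rfl
  two_le := le_max_left _ _

lemma exists_bound_of_checkBlocks {T : Fin 5 → Fin 4 → Fin 8}
    (hT : ∀ i, Function.Injective (T i)) {R : List ℕ}
    (hR : ∀ i : Fin 5, rowMask (T i) = R.getD i 0) {L : List ℕ} {n D : ℕ} (hn : 3 ≤ n)
    (hlt : ∀ i : Fin 5, (i : ℕ) + 3 < n → ∀ j, (T i j : ℕ) < n) (h : Bound T n D)
    (hL : checkBlocks R L n D = true) : ∃ D ≤ 4, Bound T 8 D := by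
  fun_induction checkBlocks R L n D with
  | case1 n D =>
    simp only [Bool.and_eq_true, Nat.beq_eq, Nat.ble_eq] at hL
    exact ⟨D, hL.2, hL.1 ▸ h⟩
  | case2 => simp at hL
  | case3 L n D ih =>
    simp only [Bool.and_eq_true, Nat.beq_eq, Nat.ble_eq] at hL
    obtain ⟨⟨h7, hrow⟩, hL⟩ := hL
    obtain ⟨r, rfl⟩ : ∃ r : Fin 8, (r : ℕ) = n := ⟨⟨n, by omega⟩, rfl⟩
    have hrow' : ∀ i : Fin 5, (i : ℕ) + 3 = r →
        ∃ j₀, T i j₀ = r ∧ ∀ j, j ≠ j₀ → T i j < r := fun i hi => by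
      rw [show (r : ℕ) - 3 = i by omega, ← hR] at hrow
      obtain ⟨j₀, h0, hj⟩ := rowMask_shiftRight_eq_one (hT i) hrow
      exact ⟨j₀, Fin.ext h0, hj⟩
    refine ih (by omega) (fun i hi j => ?_) (.single hT hn hlt hrow' h) hL
    by_cases h1 : (i : ℕ) + 3 < r
    · exact (hlt i h1 j).trans (Nat.lt_succ_self _)
    · obtain ⟨j₀, h0, hj⟩ := hrow' i (by omega)
      by_cases h2 : j = j₀
      · rw [h2, h0]
        exact Nat.lt_succ_self _
      · exact (Fin.lt_def.mp (hj j h2)).trans (Nat.lt_succ_self _)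
  | case4 k L n D ih =>
    simp only [Bool.and_eq_true, Nat.beq_eq, Nat.ble_eq, List.all_eq_true, List.mem_range] at hL
    obtain ⟨⟨⟨h8, htree⟩, hclosing⟩, hL⟩ := hL
    obtain ⟨r, rfl⟩ : ∃ r : Fin 8, (r : ℕ) = n := ⟨⟨n, by omega⟩, rfl⟩
    have hB := treeBlock_of_masks hT hR hn h8 hlt htree hclosing
    exact ih (by omega) hB.lt_of_rel (h.treeBlock hT hB) hL

/-- A relabelling `w`, the relabelled and reordered first four index sets, the position where the
fifth one goes, and sizes of blocks for `checkBlocks`. -/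
structure Certificate where
  w : ℕ
  rows : List ℕ
  pos : ℕ
  blocks : List ℕ

/-- The certificate `C` is about the four index sets in `c`. -/
def Certificate.fits (C : Certificate) (c : List ℕ) : Bool :=
  Nat.beq (relabel C.w 255) 255 && (c.map (relabel C.w)).isPerm C.rows && Nat.ble C.pos 4

/-- The certificate `C` works for the fifth index set `s`. -/
def Certificate.covers (C : Certificate) (s : ℕ) : Bool :=
  evalFirst (fun m => checkBlocks (C.rows.insertIdx C.pos m) C.blocks 3 1) (relabel C.w s)

lemma MasksBounded.of_certificate {C : Certificate} {c : List ℕ} {s : ℕ} (hl : c.length = 4)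
    (h : C.fits c = true) (hs : C.covers s = true) : MasksBounded (s :: c) := by
  simp only [Certificate.fits, Certificate.covers, evalFirst_eq, Bool.and_eq_true, Nat.beq_eq,
    Nat.ble_eq, List.isPerm_iff] at h hs
  obtain ⟨⟨hw, hperm⟩, hp⟩ := h
  have hlen := hperm.length_eq
  rw [List.length_map, hl] at hlen
  have hins : (C.rows.insertIdx C.pos (relabel C.w s)).Perm ((s :: c).map (relabel C.w)) :=
    (List.perm_insertIdx _ _ (by omega)).trans (hperm.symm.cons _)
  refine .of_relabel hw (.perm (.of_forall ?_ fun T hT hTl => ?_) hins.symm)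
  · rw [hins.length_eq, List.length_map, List.length_cons, hl]
  obtain ⟨D, hD, hB⟩ := exists_bound_of_checkBlocks hT hTl le_rfl (fun i hi => by omega)
    (Bound.three T) hs
  exact ⟨1, 1, D, hD, hB⟩

/-- Bit masks of the four-element subsets of `{0, …, 7}`. -/
def fourMasks : List ℕ := [
  15, 23, 27, 29, 30, 39, 43, 45, 46, 51, 53, 54, 57, 58, 60, 71, 75, 77, 78, 83, 85, 86, 89,
  90, 92, 99, 101, 102, 105, 106, 108, 113, 114, 116, 120, 135, 139, 141, 142, 147, 149, 150,
  153, 154, 156, 163, 165, 166, 169, 170, 172, 177, 178, 180, 184, 195, 197, 198, 201, 202, 204,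
  209, 210, 212, 216, 225, 226, 228, 232, 240]

lemma filter_countFrom_eq_fourMasks :
    ((List.range 256).filter fun m => Nat.beq (countFrom 0 m) 4) = fourMasks := by
  decide +kernel

/-- `m` is the index set of an equation. -/
def IsRow (m : ℕ) : Prop := ∃ e : Fin 4 → Fin 8, Function.Injective e ∧ rowMask e = m

lemma IsRow.mem_fourMasks {m : ℕ} (h : IsRow m) : m ∈ fourMasks := by
  obtain ⟨e, he, rfl⟩ := h
  rw [← filter_countFrom_eq_fourMasks, List.mem_filter, List.mem_range, Nat.beq_eq]
  refine ⟨?_, by simp [countFrom_rowMask he]⟩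
  have h2 : ∀ j, 2 ^ (e j : ℕ) < 2 ^ 8 := fun j => Nat.pow_lt_pow_right (by omega) (e j).isLt
  exact Nat.or_lt_two_pow (Nat.or_lt_two_pow (Nat.or_lt_two_pow (h2 0) (h2 1)) (h2 2)) (h2 3)

lemma IsRow.relabel {w m : ℕ} (hw : relabel w 255 = 255) (h : IsRow m) :
    IsRow (relabel w m) := by
  obtain ⟨σ, hσ⟩ := exists_perm_of_relabel hw
  obtain ⟨e, he, rfl⟩ := h
  exact ⟨fun j => σ (e j), σ.injective.comp he, hσ e⟩

/-- All ways to complete `c` to five index sets are four-bounded. -/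
def ExtensionsBounded (c : List ℕ) : Prop :=
  ∀ l, (∀ m ∈ l, IsRow m) → (c ++ l).length = 5 → MasksBounded (c ++ l)

lemma ExtensionsBounded.of_cons {c : List ℕ} (hc : c.length < 5)
    (h : ∀ s ∈ fourMasks, ExtensionsBounded (s :: c)) : ExtensionsBounded c := by
  rintro (_ | ⟨s, l⟩) hl h5
  · simp only [List.append_nil] at h5
    omega
  · have hp : (s :: c ++ l).Perm (c ++ s :: l) := List.perm_middle.symm
    exact (h s (hl s (by simp)).mem_fourMasks l (fun m hm => hl m (by simp [hm]))
      (hp.length_eq.trans h5)).perm hp.symm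

lemma ExtensionsBounded.of_overdetermined {c : List ℕ} (h : overdetermined c 0 0 = true) :
    ExtensionsBounded c := fun l _ h5 => .of_overdetermined h l h5

/-- The list `l` becomes a permutation of a member of `N` after relabelling; the position in `N`
and the relabelling are the leading part and the last eight decimal digits of `w`. -/
def checkRelabel (N : List (List ℕ)) (l : List ℕ) (w : ℕ) : Bool :=
  Nat.beq (relabel w 255) 255 && (l.map (relabel w)).isPerm (N.getD (w / 10 ^ 8) [])

lemma ExtensionsBounded.of_checkRelabel {N : List (List ℕ)}
    (hN : ∀ d ∈ N, ExtensionsBounded d) {l : List ℕ} (hl : l ≠ []) {w : ℕ}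
    (h : checkRelabel N l w = true) : ExtensionsBounded l := by
  simp only [checkRelabel, Bool.and_eq_true, Nat.beq_eq, List.isPerm_iff] at h
  obtain ⟨hw, hp⟩ := h
  have hi : w / 10 ^ 8 < N.length := by
    by_contra! hi
    rw [List.getD_eq_default _ _ hi] at hp
    simpa using hl (List.map_eq_nil_iff.mp hp.eq_nil)
  rw [List.getD_eq_getElem _ _ hi] at hp
  intro l' hl' h5
  have hp' := hp.append_right (l'.map (relabel w))
  refine .of_relabel hw ?_
  rw [List.map_append]
  refine (hN _ (List.getElem_mem hi) (l'.map (relabel w)) ?_ ?_).perm hp'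
  · simp only [List.mem_map]
    rintro m ⟨m', hm', rfl⟩
    exact (hl' m' hm').relabel hw
  · rw [← hp'.length_eq, ← List.map_append, List.length_map, h5]

/-- The codes in `t.2` treat the extensions of `t.1` by one more index set. -/
def checkStep (N : List (List ℕ)) (t : List ℕ × List ℕ) : Bool :=
  Nat.ble t.1.length 4 && (fourMasks.zipIdx.all fun s =>
    bif Nat.beq (t.2.getD s.2 0) 0 then overdetermined (s.1 :: t.1) 0 0
    else checkRelabel N (s.1 :: t.1) (t.2.getD s.2 0))

lemma ExtensionsBounded.of_checkStep {N : List (List ℕ)} (hN : ∀ d ∈ N, ExtensionsBounded d)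
    {t : List (List ℕ × List ℕ)} (h : t.all (checkStep N) = true) :
    ∀ c ∈ t.map Prod.fst, ExtensionsBounded c := by
  simp only [List.all_eq_true, List.mem_map] at h ⊢
  rintro c ⟨t, ht, rfl⟩
  have := h t ht
  simp only [checkStep, Bool.and_eq_true, Nat.ble_eq, List.all_eq_true] at this
  refine .of_cons (Nat.lt_succ_of_le this.1) fun s hs => ?_
  obtain ⟨i, hi, rfl⟩ := List.getElem_of_mem hs
  have hs := this.2 (fourMasks[i], i) (List.mk_mem_zipIdx_iff_getElem?.mpr (by simp [hi]))
  dsimp only at hs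
  cases hb : Nat.beq (t.2.getD i 0) 0 <;> rw [hb] at hs
  · exact .of_checkRelabel hN (by simp) hs
  · exact .of_overdetermined hs

/-- The certificates in `t.2` treat the extensions of `t.1` by a fifth index set. -/
def checkLast (t : List ℕ × List Certificate) : Bool :=
  Nat.beq t.1.length 4 && (t.2.all fun C => C.fits t.1) && (fourMasks.all fun s =>
    t.2.any (fun C => C.covers s) || overdetermined (s :: t.1) 0 0)

lemma ExtensionsBounded.of_checkLast {t : List (List ℕ × List Certificate)}
    (h : t.all checkLast = true) : ∀ c ∈ t.map Prod.fst, ExtensionsBounded c := by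
  simp only [List.all_eq_true, List.mem_map] at h ⊢
  rintro c ⟨t, ht, rfl⟩
  have := h t ht
  simp only [checkLast, Bool.and_eq_true, Nat.beq_eq, List.all_eq_true, Bool.or_eq_true,
    List.any_eq_true] at this
  obtain ⟨⟨h4, hfit⟩, hall⟩ := this
  refine .of_cons (by omega) fun s hs => ?_
  rcases hall s hs with ⟨C, hC, hcov⟩ | hs
  · intro l _ h5
    obtain rfl : l = [] := List.eq_nil_of_length_eq_zero (by
      rw [List.length_append, List.length_cons] at h5
      omega)
    rw [List.append_nil]
    exact .of_certificate h4 (hfit C hC) hcov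
  · exact .of_overdetermined hs

/-- Reduction steps for no index set. -/
def stepsZero : List (List ℕ × List ℕ) := [
  ([], [
    32107654, 32170654, 32176054, 32176504, 32176540, 32710654, 32716054, 32716504, 32716540,
    32761054, 32761504, 32761540, 32765104, 32765140, 32765410, 37210654, 37216054, 37216504,
    37216540, 37261054, 37261504, 37261540, 37265104, 37265140, 37265410, 37621054, 37621504,
    37621540, 37625104, 37625140, 37625410, 37652104, 37652140, 37652410, 37654210, 73210654,
    73216054, 73216504, 73216540, 73261054, 73261504, 73261540, 73265104, 73265140, 73265410,
    73621054, 73621504, 73621540, 73625104, 73625140, 73625410, 73652104, 73652140, 73652410,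
    73654210, 76321054, 76321504, 76321540, 76325104, 76325140, 76325410, 76352104, 76352140,
    76352410, 76354210, 76532104, 76532140, 76532410, 76534210, 76543210])]

/-- Reduction steps for one index set. -/
def stepsOne : List (List ℕ × List ℕ) := [
  ([240], [
    376543210, 265470321, 265473021, 265473201, 265473210, 265740321, 265743021, 265743201,
    265743210, 154761032, 154761302, 154761320, 154763102, 154763120, 154763210, 267540321,
    267543021, 267543201, 267543210, 157461032, 157461302, 157461320, 157463102, 157463120,
    157463210, 157641032, 157641302, 157641320, 157643102, 157643120, 157643210, 47652103,
    47652130, 47652310, 47653210, 276540321, 276543021, 276543201, 276543210, 175461032, 175461302,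
    175461320, 175463102, 175463120, 175463210, 175641032, 175641302, 175641320, 175643102,
    175643120, 175643210, 74652103, 74652130, 74652310, 74653210, 176541032, 176541302, 176541320,
    176543102, 176543120, 176543210, 76452103, 76452130, 76452310, 76453210, 76542103, 76542130,
    76542310, 76543210, 0])]

/-- Reduction steps for two index sets. -/
def stepsTwo : List (List ℕ × List ℕ) := [
  ([232, 240], [
    1076534210, 1076543210, 676543021, 676543201, 676543210, 965743210, 565734021, 565734201,
    565734210, 565743021, 565743201, 565743210, 265743102, 265743120, 265743210, 967543210,
    567534021, 567534201, 567534210, 567543021, 567543201, 567543210, 267543102, 267543120,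
    267543210, 457643021, 457643201, 457643210, 157634102, 157634120, 157634210, 157643102,
    157643120, 157643210, 0, 976543210, 576534021, 576534201, 576534210, 576543021, 576543201,
    576543210, 276543102, 276543120, 276543210, 475643021, 475643201, 475643210, 175634102,
    175634120, 175634210, 175643102, 175643120, 175643210, 0, 476543021, 476543201, 476543210,
    176534102, 176534120, 176534210, 176543102, 176543120, 176543210, 0, 76543102, 76543120,
    76543210, 0, 0]),
  ([204, 240], [
    1376325410, 1476452310, 1476453210, 876235401, 876235410, 1476542310, 1476543210, 876325401,
    876325410, 1376543210, 876542301, 876542310, 876543201, 876543210, 376543210, 1267324510,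
    1267325410, 547216503, 547216530, 1267453210, 767452301, 767452310, 767453201, 767453210,
    247236510, 1267543210, 767542301, 767542310, 767543201, 767543210, 247326510, 547652103,
    547652130, 247652310, 247653210, 1276324510, 1276325410, 574216503, 574216530, 1276453210,
    776452301, 776452310, 776453201, 776453210, 274236510, 1276543210, 776542301, 776542310,
    776543201, 776543210, 274326510, 574652103, 574652130, 274652310, 274653210, 1176543210,
    476214503, 476214530, 476215403, 476215430, 0, 476452103, 476452130, 176352410, 176354210,
    476542103, 476542130, 176532410, 176534210, 0]),
  ([142, 240], [
    1042107653, 1451034762, 1451037462, 1451037642, 642137650, 1451304762, 1451307462, 1451307642,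
    642317650, 1454761032, 1454761302, 832761540, 1454763102, 832765140, 832765410, 1453104762,
    1453107462, 1453107642, 643217650, 1457461032, 1457461302, 837261540, 1457463102, 837265140,
    837265410, 1457641032, 1457641302, 837621540, 1457643102, 837625140, 837625410, 1047652103,
    647652130, 647652310, 647653210, 972104653, 972106453, 972106543, 0, 1273261054, 1273261504,
    572143650, 1273265104, 572146350, 572146530, 1273621054, 1273621504, 572413650, 1273625104,
    572416350, 572416530, 974652103, 573652140, 573652410, 573654210, 1276321054, 1276321504,
    574213650, 1276325104, 574216350, 574216530, 976452103, 576352140, 576352410, 576354210,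
    976542103, 576532140, 576532410, 576534210, 0]),
  ([15, 240], [
    0, 1021043765, 1021047365, 1021047635, 1021047653, 1021403765, 1021407365, 1021407635,
    1021407653, 1332761054, 1332761504, 1332761540, 1332765104, 1332765140, 1332765410, 1024103765,
    1024107365, 1024107635, 1024107653, 1337261054, 1337261504, 1337261540, 1337265104, 1337265140,
    1337265410, 1337621054, 1337621504, 1337621540, 1337625104, 1337625140, 1337625410, 1037652104,
    1037652140, 1037652410, 1037654210, 1042103765, 1042107365, 1042107635, 1042107653, 1373261054,
    1373261504, 1373261540, 1373265104, 1373265140, 1373265410, 1373621054, 1373621504, 1373621540,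
    1373625104, 1373625140, 1373625410, 1073652104, 1073652140, 1073652410, 1073654210, 1376321054,
    1376321504, 1376321540, 1376325104, 1376325140, 1376325410, 1076352104, 1076352140, 1076352410,
    1076354210, 1076532104, 1076532140, 1076532410, 1076534210, 0])]

/-- Reduction steps for three index sets. -/
def stepsThree : List (List ℕ × List ℕ) := [
  ([228, 232, 240], [
    3176524310, 3176542310, 3176543210, 1076543201, 1076543210, 2765732410, 2765734210, 365724301,
    365724310, 2765743210, 365742301, 365742310, 365743201, 365743210, 0, 2767532410, 2767534210,
    367524301, 367524310, 2767543210, 367542301, 367542310, 367543201, 367543210, 0, 2657643210,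
    157632401, 157632410, 157634201, 157634210, 0, 157643201, 157643210, 0, 0, 2776532410,
    2776534210, 376524301, 376524310, 2776543210, 376542301, 376542310, 376543201, 376543210, 0,
    2675643210, 175632401, 175632410, 175634201, 175634210, 0, 175643201, 175643210, 0, 0,
    2676543210, 176532401, 176532410, 176534201, 176534210, 0, 176543201, 176543210, 0, 0,
    76543201, 76543210, 0, 0, 0]),
  ([212, 232, 240], [
    4076543210, 3376452310, 3476543210, 1276452301, 1276452310, 3476452310, 3376543210, 1276543201,
    1276543210, 3076543210, 776452301, 776452310, 776543201, 776543210, 0, 3267452310, 3267543210,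
    1167543201, 1167543210, 2967452310, 567452301, 567452310, 667543201, 667543210, 0, 2967543210,
    667452301, 667452310, 567543201, 567543210, 0, 267543201, 267543210, 0, 0, 3276452310,
    3276543210, 1176543201, 1176543210, 2976452310, 576452301, 576452310, 676543201, 676543210, 0,
    2976543210, 676452301, 676452310, 576543201, 576543210, 0, 276543201, 276543210, 0, 0,
    2876543210, 476452301, 476452310, 476543201, 476543210, 0, 176451302, 176451320, 0, 0,
    176543102, 176543120, 0, 0, 0]),
  ([156, 232, 240], [
    4376534210, 4376543210, 3976543210, 1776543201, 1776543210, 4275643210, 3875634210, 1675634201,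
    1675634210, 3875643210, 1675643201, 1675643210, 975643201, 975643210, 0, 4276543210,
    3876534210, 1676534201, 1676534210, 3876543210, 1676543201, 1676543210, 976543201, 976543210,
    0, 3676543210, 1476543201, 1476543210, 757634102, 757634120, 0, 757643102, 757643120, 0, 0,
    4176543210, 3776534210, 1576534201, 1576534210, 3776543210, 1576543201, 1576543210, 876543201,
    876543210, 0, 3575643210, 1375643201, 1375643210, 675634102, 675634120, 0, 675643102,
    675643120, 0, 0, 3576543210, 1376543201, 1376543210, 676534102, 676534120, 0, 676543102,
    676543120, 0, 0, 376543102, 376543120, 0, 0, 0]),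
  ([60, 204, 240], [
    4454327610, 4532674510, 4532675410, 1832457601, 1832457610, 4532764510, 4532765410, 1832547601,
    1832547610, 4454763210, 1832764501, 1832764510, 1832765401, 1832765410, 0, 4567324510,
    4567325410, 1845327601, 1845327610, 4567453210, 1967452301, 1967452310, 1967453201, 1967453210,
    0, 4567543210, 1967542301, 1967542310, 1967543201, 1967543210, 0, 1845763201, 1845763210, 0, 0,
    4576324510, 4576325410, 1854327601, 1854327610, 4576453210, 1976452301, 1976452310, 1976453201,
    1976453210, 0, 4576543210, 1976542301, 1976542310, 1976543201, 1976543210, 0, 1854763201,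
    1854763210, 0, 0, 4476543210, 1876324501, 1876324510, 1876325401, 1876325410, 0, 1876453201,
    1876453210, 0, 0, 1876543201, 1876543210, 0, 0, 0]),
  ([198, 232, 240], [
    6176514320, 6176541320, 5276543120, 5276543210, 2076543210, 5876321540, 4976534120, 4976534210,
    1876514320, 4976543120, 4976543210, 1876541320, 3665743102, 1465743120, 1465743210, 5047210653,
    4867534120, 4867534210, 1547213650, 4867543120, 4867543210, 1547231650, 3567543102, 1367543120,
    1367543210, 4767543120, 4767543210, 847321650, 2957634102, 647625130, 647625310, 2957643102,
    647652130, 647652310, 0, 5074210653, 4876534120, 4876534210, 1574213650, 4876543120,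
    4876543210, 1574231650, 3576543102, 1376543120, 1376543210, 4776543120, 4776543210, 874321650,
    2975634102, 674625130, 674625310, 2975643102, 674652130, 674652310, 0, 4676543120, 4676543210,
    0, 2876534102, 476425130, 476425310, 2876543102, 476452130, 476452310, 0, 2676543102,
    176532140, 176532410, 0, 0]),
  ([150, 232, 240], [
    7076543210, 6375461320, 5576543120, 5576543210, 2376543210, 6474561320, 5475643120, 5475643210,
    2275643210, 5175643120, 5175643210, 1742371650, 3865743102, 1665743120, 1665743210, 6475461320,
    5476543120, 5476543210, 2276543210, 5176543120, 5176543210, 1743271650, 3867543102, 1667543120,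
    1667543210, 4957643021, 4957643201, 1857641320, 3357634102, 1257634120, 1257634210, 3057643102,
    747652130, 747652310, 0, 6275461320, 5376543120, 5376543210, 2176543210, 5076543120,
    5076543210, 0, 3776543102, 1576543120, 1576543210, 4875643021, 4875643201, 1572431650,
    3275634102, 1175634120, 1175634210, 2974652103, 574652130, 574652310, 0, 4876543021,
    4876543201, 1574231650, 3276534102, 1176534120, 1176534210, 2976452103, 576452130, 576452310,
    0, 2776543102, 376542130, 376542310, 0, 0]),
  ([30, 232, 240], [
    7276534210, 7276543210, 5676543120, 5676543210, 0, 7165743210, 5565734021, 5565734201,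
    2365734210, 5565743021, 5565743201, 2365743210, 3965743102, 1765743120, 1765743210, 7167543210,
    5567534021, 5567534201, 2367534210, 5567543021, 5567543201, 2367543210, 3967543102, 1767543120,
    1767543210, 5257643021, 5257643201, 2057643210, 3457634102, 1247625130, 1247625310, 3457643102,
    1247652130, 1247652310, 0, 7176543210, 5576534021, 5576534201, 2376534210, 5576543021,
    5576543201, 2376543210, 3976543102, 1776543120, 1776543210, 5275643021, 5275643201, 2075643210,
    3475634102, 1274625130, 1274625310, 3475643102, 1274652130, 1274652310, 0, 5276543021,
    5276543201, 2076543210, 3476534102, 1276425130, 1276425310, 3476543102, 1276452130, 1276452310,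
    0, 3176543102, 1076543120, 1076543210, 0, 0]),
  ([170, 204, 240], [
    6675316420, 7376543210, 6773625140, 6776325410, 2575316420, 6773516240, 5142716053, 6075316420,
    1642617350, 6675643120, 6776543210, 2575643120, 6075643120, 1642736150, 1976543210, 6775316420,
    6073516240, 5147216503, 1646217530, 6775643120, 6676543210, 2576543210, 6076543210, 1975643120,
    1647236510, 6073625140, 6076325410, 1975316420, 5776543210, 943726150, 947326510, 5147652103,
    1646752130, 1647652310, 947653210, 6575316420, 4872406153, 4874206513, 1173216540, 6575643120,
    6576543210, 2476543210, 5976543210, 1372436150, 1374236510, 4872614053, 5976325410, 1372614350,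
    4772615043, 0, 673416520, 4874652013, 1173652140, 1374652310, 673654120, 5973625140,
    4876214503, 1376214530, 4776215403, 674316250, 0, 4876452103, 1376452130, 1176352410,
    676354210, 4776542103, 674623150, 676423510, 276534210, 0]),
  ([58, 204, 240], [
    7576543210, 7454673120, 6432675041, 6976453210, 2221476350, 7454763120, 6432765041, 6976543210,
    2221746350, 6132764051, 6876543210, 2021764350, 5854763021, 0, 1832765410, 7467543210,
    6945763120, 6467325401, 2247216530, 6745672031, 6767452301, 2557461320, 6057463102, 1624376150,
    1637246510, 6745762031, 6767542301, 2557641320, 6057643102, 1624736150, 1637426510, 4945762013,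
    1235762140, 1447652310, 735764120, 7476543210, 6954763120, 6476325401, 2274216530, 6754672031,
    6776452301, 2575461320, 6075463102, 1642376150, 1673246510, 6754762031, 6776542301, 2575641320,
    6075643102, 1642736150, 1673426510, 4954762013, 1253762140, 1474652310, 753764120, 6854763120,
    6176324501, 2076214530, 5876543201, 1876325140, 0, 4976452103, 1465472130, 1276352410,
    776354210, 4976542103, 1465742130, 1276532410, 776534210, 0]),
  ([135, 232, 240], [
    7242103765, 7242130765, 7176543021, 7176543201, 7176543210, 5642310765, 6454716032, 6454716302,
    6454716320, 6454761032, 6454761302, 6454761320, 4265743102, 4265743120, 4265743210, 5643210765,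
    6457416032, 6457416302, 6457416320, 6457461032, 6457461302, 6457461320, 4267543102, 4267543120,
    4267543210, 5837621054, 5837621504, 5837621540, 3447625103, 3447625130, 3447625310, 3447652103,
    3447652130, 3447652310, 0, 0, 6275416032, 6275416302, 6275416320, 6275461032, 6275461302,
    6275461320, 4176543102, 4176543120, 4176543210, 5072410365, 5072410635, 5072410653, 3274625103,
    3274625130, 3274625310, 3274652103, 3274652130, 3274652310, 0, 5074210365, 5074210635,
    5074210653, 3276425103, 3276425130, 3276425310, 3276452103, 3276452130, 3276452310, 0,
    2776532104, 2776532140, 2776532410, 0, 0]),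
  ([23, 232, 240], [
    7676543210, 0, 7276543021, 7276543201, 7276543210, 7221430765, 7065734021, 7065734201,
    7065734210, 6354761032, 6354761302, 6354761320, 4365743102, 4365743120, 4365743210, 7224130765,
    7067534021, 7067534201, 7067534210, 6357461032, 6357461302, 6357461320, 4367543102, 4367543120,
    4367543210, 6157641032, 6157641302, 6157641320, 4057634102, 4057634120, 4057634210, 3347652103,
    3347652130, 3347652310, 0, 7242130765, 7076534021, 7076534201, 7076534210, 6375461032,
    6375461302, 6375461320, 4376543102, 4376543120, 4376543210, 6175641032, 6175641302, 6175641320,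
    4075634102, 4075634120, 4075634210, 3374652103, 3374652130, 3374652310, 0, 6176541032,
    6176541302, 6176541320, 4076534102, 4076534120, 4076534210, 3376452103, 3376452130, 3376452310,
    0, 3176542103, 3176542130, 3176542310, 0, 0]),
  ([195, 204, 240], [
    4476105432, 6854130276, 6854132076, 6854137602, 6854137620, 6854310276, 6854312076, 6854317602,
    6854317620, 4476541032, 6854761302, 6854761320, 6854763102, 6854763120, 4476543210, 3747102365,
    3747103265, 3747106523, 3747106532, 3747231065, 5937261504, 5937261540, 5937265104, 5937265140,
    3747236510, 3747321065, 5937621504, 5937621540, 5937625104, 5937625140, 3747326510, 3747651023,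
    3747651032, 3747652310, 3747653210, 3774102365, 3774103265, 3774106523, 3774106532, 3774231065,
    5973261504, 5973261540, 5973265104, 5973265140, 3774236510, 3774321065, 5973621504, 5973621540,
    5973625104, 5973625140, 3774326510, 3774651023, 3774651032, 3774652310, 3774653210, 0,
    2876103524, 2876103542, 2876105324, 2876105342, 0, 2876351024, 2876351042, 2876352410,
    2876354210, 2876531024, 2876531042, 2876532410, 2876534210, 0]),
  ([163, 204, 240], [
    7532107654, 7472630154, 7472631054, 7476235401, 7476235410, 5542710365, 5542713065, 6954317602,
    6954317620, 4342731065, 6754760213, 6754760231, 6754762013, 6754762031, 4576543210, 6953410276,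
    6953412076, 5547216503, 5547216530, 4575641032, 6757461302, 6757461320, 6757463102, 6757463120,
    4347236510, 3943721065, 6037621504, 6037621540, 6037625104, 6037625140, 3947326510, 3846751023,
    3846751032, 3847652310, 3847653210, 5372410365, 5372413065, 5374216503, 5374216530, 4172431065,
    6575461302, 6575461320, 6575463102, 6575463120, 4174236510, 0, 4872610435, 4872610453,
    4872614035, 4872614053, 3773426510, 3273651024, 3273651042, 3574652310, 3574653210, 3774321065,
    4876213504, 4876213540, 4876215304, 4876215340, 0, 3576451023, 3576451032, 3276352410,
    3276354210, 2975631024, 2975631042, 2976532410, 2976534210, 0]),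
  ([51, 204, 240], [
    7776543210, 7021470365, 7021473065, 7576235401, 7576235410, 7021740365, 7021743065, 7576325401,
    7576325410, 0, 6132760415, 6132760451, 6132764015, 6132764051, 4454763210, 7523760154,
    7523761054, 7047216503, 7047216530, 4324371065, 6657461302, 6657461320, 6657463102, 6657463120,
    4337246510, 4324731065, 6657641302, 6657641320, 6657643102, 6657643120, 4337426510, 3335761024,
    3335761042, 3647652310, 3647653210, 7532760154, 7532761054, 7074216503, 7074216530, 4342371065,
    6675461302, 6675461320, 6675463102, 6675463120, 4373246510, 4342731065, 6675641302, 6675641320,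
    6675643102, 6675643120, 4373426510, 3353761024, 3353761042, 3674652310, 3674653210, 4476541032,
    6176321504, 6176321540, 6176325104, 6176325140, 0, 3665471023, 3665471032, 3376352410,
    3376354210, 3665741023, 3665741032, 3376532410, 3376534210, 0]),
  ([43, 204, 240], [
    7021307465, 7876543210, 7121437065, 7454137602, 7454137620, 7121704365, 0, 6432507614,
    6432507641, 7021743065, 7454761302, 7454761320, 6432765014, 6432765041, 4532765410, 7427103654,
    5524307165, 5447216503, 5447216530, 7427361054, 7367452301, 7367452310, 6737265104, 6737265140,
    4247236510, 5524713065, 6737512604, 6737512640, 5124716035, 5124716053, 3837426510, 5447652103,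
    5447652130, 4247652310, 3837654210, 7472103654, 5542307165, 5474216503, 5474216530, 7472361054,
    7376452301, 7376452310, 6773265104, 6773265140, 4274236510, 5542713065, 6773512604, 6773512640,
    5142716035, 5142716053, 3873426510, 5474652103, 5474652130, 4274652310, 3873654210, 6854312076,
    5276214503, 5276214530, 4976215304, 4976215340, 0, 5276452103, 5276452130, 4076352410,
    3476354210, 4976532104, 4976532140, 3476423510, 3076534210, 0])]

/-- Certificates for four index sets. -/
def lastSteps : List (List ℕ × List Certificate) := [
  ([226, 228, 232, 240], [
    ⟨42176530, [30, 54, 86, 150], 4, [5]⟩]),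
  ([210, 228, 232, 240], [
    ⟨21547630, [30, 54, 102, 166], 4, [5]⟩]),
  ([178, 212, 232, 240], [
    ⟨34216507, [15, 30, 58, 92], 4, [1, 1, 1, 1, 1]⟩]),
  ([154, 228, 232, 240], [
    ⟨32154067, [15, 30, 46, 120], 4, [1, 1, 1, 1, 1]⟩]),
  ([202, 212, 232, 240], [
    ⟨21564730, [30, 54, 102, 198], 4, [5]⟩]),
  ([170, 212, 232, 240], [
    ⟨34251607, [15, 30, 60, 120], 4, [1, 1, 1, 1, 1]⟩]),
  ([154, 212, 232, 240], [
    ⟨32415067, [15, 30, 60, 106], 4, [1, 1, 1, 1, 1]⟩]),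
  ([58, 212, 232, 240], [
    ⟨32415067, [15, 30, 60, 114], 4, [1, 1, 1, 1, 1]⟩]),
  ([154, 156, 232, 240], [
    ⟨32140657, [15, 30, 57, 89], 4, [1, 1, 1, 1, 1]⟩]),
  ([90, 156, 232, 240], [
    ⟨32140657, [15, 30, 53, 89], 4, [1, 1, 1, 1, 1]⟩]),
  ([30, 228, 232, 240], [
    ⟨32154067, [15, 30, 46, 113], 4, [1, 1, 1, 1, 1]⟩]),
  ([142, 212, 232, 240], [
    ⟨32415067, [15, 30, 60, 105], 4, [1, 1, 1, 1, 1]⟩]),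
  ([46, 212, 232, 240], [
    ⟨32415067, [15, 30, 60, 113], 4, [1, 1, 1, 1, 1]⟩]),
  ([156, 198, 232, 240], [
    ⟨32140567, [15, 30, 57, 108], 4, [1, 1, 1, 1, 1]⟩]),
  ([102, 156, 232, 240], [
    ⟨32140567, [15, 30, 57, 102], 4, [1, 1, 1, 1, 1]⟩]),
  ([150, 156, 232, 240], [
    ⟨32140567, [15, 30, 57, 120], 4, [1, 1, 1, 1, 1]⟩]),
  ([86, 156, 232, 240], [
    ⟨32140567, [15, 30, 57, 116], 4, [1, 1, 1, 1, 1]⟩]),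
  ([30, 156, 232, 240], [
    ⟨32140567, [15, 30, 57, 113], 4, [1, 1, 1, 1, 1]⟩]),
  ([60, 204, 226, 240], [
    ⟨43216507, [29, 30, 102, 120], 4, [2, 2, 1]⟩]),
  ([60, 170, 204, 240], [
    ⟨56432107, [30, 53, 102, 120], 4, [4, 1]⟩]),
  ([30, 198, 232, 240], [
    ⟨32654107, [15, 51, 92, 108], 4, [1, 3, 1]⟩]),
  ([142, 150, 232, 240], [
    ⟨36542107, [15, 27, 108, 120], 4, [1, 1, 2, 1]⟩]),
  ([78, 150, 232, 240], [
    ⟨53642107, [15, 51, 108, 120], 4, [1, 3, 1]⟩]),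
  ([30, 150, 232, 240], [
    ⟨46532107, [15, 27, 116, 120], 4, [1, 1, 2, 1]⟩]),
  ([150, 170, 204, 240], [
    ⟨46532107, [27, 53, 86, 120], 4, [4, 1]⟩]),
  ([86, 170, 204, 240], [
    ⟨54632107, [27, 54, 101, 120], 4, [4, 1]⟩]),
  ([195, 228, 232, 240], [
    ⟨32576410, [15, 60, 108, 172], 4, [1, 4]⟩]),
  ([147, 228, 232, 240], [
    ⟨25147630, [29, 54, 102, 166], 4, [5]⟩]),
  ([195, 212, 232, 240], [
    ⟨32657410, [15, 60, 108, 204], 4, [1, 4]⟩]),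
  ([163, 212, 232, 240], [
    ⟨21465730, [29, 54, 86, 198], 4, [5]⟩]),
  ([51, 212, 232, 240], [
    ⟨32415076, [15, 30, 60, 210], 4, [1, 1, 1, 2]⟩]),
  ([27, 228, 232, 240], [
    ⟨32154076, [15, 30, 46, 240], 4, [1, 1, 1, 2]⟩]),
  ([139, 212, 232, 240], [
    ⟨21564730, [29, 54, 102, 198], 4, [5]⟩]),
  ([43, 212, 232, 240], [
    ⟨32415076, [15, 30, 60, 240], 4, [1, 1, 1, 2]⟩]),
  ([27, 212, 232, 240], [
    ⟨32415076, [15, 30, 60, 226], 4, [1, 1, 1, 2]⟩]),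
  ([156, 195, 232, 240], [
    ⟨32140576, [15, 30, 57, 204], 4, [1, 1, 1, 2]⟩]),
  ([99, 156, 232, 240], [
    ⟨32140576, [15, 30, 57, 198], 4, [1, 1, 1, 2]⟩]),
  ([147, 156, 232, 240], [
    ⟨32140576, [15, 30, 57, 216], 4, [1, 1, 1, 2]⟩]),
  ([83, 156, 232, 240], [
    ⟨32140576, [15, 30, 57, 212], 4, [1, 1, 1, 2]⟩]),
  ([27, 156, 232, 240], [
    ⟨32140576, [15, 30, 57, 209], 4, [1, 1, 1, 2]⟩]),
  ([15, 212, 232, 240], [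
    ⟨32415076, [15, 30, 60, 225], 4, [1, 1, 1, 2]⟩]),
  ([135, 156, 232, 240], [
    ⟨32140576, [15, 30, 57, 232], 4, [1, 1, 1, 2]⟩]),
  ([71, 156, 232, 240], [
    ⟨32140576, [15, 30, 57, 228], 4, [1, 1, 1, 2]⟩]),
  ([23, 156, 232, 240], [
    ⟨32140576, [15, 30, 57, 240], 4, [1, 1, 1, 2]⟩]),
  ([60, 195, 204, 240], [
    ⟨54321076, [15, 51, 60, 240], 4, [1, 2, 2]⟩]),
  ([60, 163, 204, 240], [
    ⟨54321076, [15, 51, 60, 232], 4, [1, 2, 2]⟩]),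
  ([197, 198, 232, 240], [
    ⟨32675140, [15, 30, 108, 204], 4, [1, 1, 3]⟩]),
  ([165, 198, 232, 240], [
    ⟨35276140, [15, 58, 108, 172], 4, [1, 4]⟩]),
  ([149, 198, 232, 240], [
    ⟨21657430, [30, 53, 102, 198], 4, [5]⟩]),
  ([53, 198, 232, 240], [
    ⟨52147063, [27, 54, 101, 166], 4, [5]⟩]),
  ([149, 150, 232, 240], [
    ⟨26147053, [29, 53, 86, 198], 4, [5]⟩]),
  ([85, 150, 232, 240], [
    ⟨21647053, [27, 53, 86, 198], 4, [5]⟩]),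
  ([29, 198, 232, 240], [
    ⟨32140675, [15, 30, 113, 204], 4, [1, 1, 3]⟩]),
  ([141, 150, 232, 240], [
    ⟨25164073, [29, 54, 102, 197], 4, [5]⟩]),
  ([77, 150, 232, 240], [
    ⟨21564073, [27, 54, 102, 197], 4, [5]⟩]),
  ([29, 150, 232, 240], [
    ⟨32140675, [15, 30, 113, 216], 4, [1, 1, 3]⟩]),
  ([29, 30, 232, 240], [
    ⟨32140675, [15, 30, 113, 209], 4, [1, 1, 3]⟩]),
  ([105, 170, 204, 240], [
    ⟨53271640, [15, 54, 106, 172], 4, [1, 4]⟩]),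
  ([57, 202, 204, 240], [
    ⟨52410763, [27, 54, 101, 165], 4, [5]⟩]),
  ([153, 170, 204, 240], [
    ⟨36521740, [15, 58, 108, 202], 4, [1, 4]⟩]),
  ([89, 170, 204, 240], [
    ⟨32651074, [15, 54, 108, 202], 4, [1, 4]⟩]),
  ([29, 204, 226, 240], [
    ⟨32651074, [15, 51, 108, 204], 4, [1, 4]⟩]),
  ([141, 178, 204, 240], [
    ⟨25614073, [29, 53, 102, 198], 4, [5]⟩]),
  ([77, 178, 204, 240], [
    ⟨43652170, [15, 30, 120, 240], 3, [1, 1, 2, 1]⟩,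
    ⟨43652170, [15, 30, 120, 240], 3, [1, 1, 3]⟩,
    ⟨43762150, [15, 30, 240, 216], 2, [1, 1, 1, 2]⟩,
    ⟨34216507, [15, 30, 120, 240], 3, [1, 1, 2, 1]⟩,
    ⟨45327610, [30, 60, 225, 240], 0, [1, 1, 1, 2]⟩]),
  ([45, 178, 204, 240], [
    ⟨25164073, [27, 53, 102, 198], 4, [5]⟩]),
  ([149, 170, 204, 240], [
    ⟨32651074, [15, 57, 108, 202], 4, [1, 4]⟩]),
  ([85, 170, 204, 240], [
    ⟨32651074, [15, 53, 108, 202], 4, [1, 4]⟩]),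
  ([53, 170, 204, 240], [
    ⟨25146073, [27, 54, 101, 198], 4, [5]⟩]),
  ([53, 58, 204, 240], [
    ⟨32106574, [15, 51, 108, 195], 4, [1, 4]⟩]),
  ([45, 58, 204, 240], [
    ⟨52160473, [27, 53, 102, 195], 4, [5]⟩]),
  ([15, 150, 232, 240], [
    ⟨25146307, [29, 54, 102, 201], 3, [4, 1]⟩,
    ⟨32140657, [15, 30, 120, 225], 3, [1, 1, 3]⟩,
    ⟨43210765, [29, 30, 225, 210], 2, [2, 1, 2]⟩,
    ⟨57643210, [15, 54, 232, 240], 2, [1, 2, 2]⟩,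
    ⟨35427106, [15, 60, 195, 184], 2, [1, 4]⟩]),
  ([30, 135, 232, 240], [
    ⟨43210657, [29, 30, 99, 240], 3, [2, 2, 1]⟩,
    ⟨32140657, [15, 30, 113, 232], 3, [1, 1, 3]⟩,
    ⟨43210765, [29, 30, 195, 240], 2, [2, 1, 2]⟩,
    ⟨37654210, [15, 54, 216, 232], 2, [1, 2, 2]⟩,
    ⟨47365210, [23, 102, 184, 216], 0, [1, 1, 3]⟩,
    ⟨43765210, [23, 102, 184, 216], 0, [1, 1, 3]⟩]),
  ([23, 30, 232, 240], [
    ⟨43210657, [29, 30, 99, 226], 3, [2, 2, 1]⟩,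
    ⟨32140657, [15, 30, 113, 240], 3, [1, 1, 3]⟩,
    ⟨43210765, [29, 30, 226, 195], 2, [2, 1, 2]⟩,
    ⟨76534210, [15, 30, 240, 232], 2, [1, 1, 1, 2]⟩,
    ⟨75634210, [15, 30, 240, 232], 2, [1, 1, 1, 2]⟩,
    ⟨57634210, [15, 30, 240, 232], 2, [1, 1, 1, 2]⟩]),
  ([23, 170, 204, 240], [
    ⟨35261407, [15, 58, 108, 209], 3, [1, 3, 1]⟩,
    ⟨35261407, [15, 58, 108, 209], 3, [1, 4]⟩,
    ⟨32561047, [15, 58, 108, 209], 3, [1, 4]⟩,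
    ⟨45213706, [29, 54, 195, 184], 2, [5]⟩,
    ⟨42513076, [29, 54, 195, 184], 2, [5]⟩]),
  ([58, 135, 204, 240], [
    ⟨52410637, [27, 54, 101, 232], 3, [4, 1]⟩,
    ⟨32105647, [15, 51, 108, 216], 3, [1, 4]⟩,
    ⟨35764210, [15, 60, 210, 232], 2, [1, 2, 2]⟩,
    ⟨67432105, [29, 99, 198, 216], 1, [5]⟩,
    ⟨43217650, [30, 113, 216, 166], 1, [2, 3]⟩]),
  ([15, 58, 204, 240], [
    ⟨52410637, [27, 54, 101, 201], 3, [4, 1]⟩,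
    ⟨32105647, [15, 51, 108, 240], 3, [1, 4]⟩,
    ⟨76543210, [15, 58, 204, 240], 2, [1, 2, 2]⟩,
    ⟨54763210, [15, 60, 202, 240], 2, [1, 2, 2]⟩,
    ⟨32106754, [15, 99, 204, 240], 1, [1, 1, 3]⟩]),
  ([15, 23, 232, 240], [
    ⟨76543210, [15, 23, 232, 240], 2, [1, 1, 1, 2]⟩,
    ⟨75643210, [15, 23, 232, 240], 2, [1, 1, 1, 2]⟩,
    ⟨57643210, [15, 23, 232, 240], 2, [1, 1, 1, 2]⟩,
    ⟨42153760, [30, 54, 201, 225], 2, [3, 2]⟩,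
    ⟨42153706, [30, 54, 201, 225], 2, [3, 2]⟩,
    ⟨42153076, [30, 54, 201, 225], 2, [3, 2]⟩,
    ⟨73265410, [51, 83, 172, 204], 0, [1, 4]⟩,
    ⟨37265410, [51, 83, 172, 204], 0, [1, 4]⟩,
    ⟨32765410, [51, 83, 172, 204], 0, [1, 4]⟩,
    ⟨73265140, [51, 83, 172, 204], 0, [1, 4]⟩,
    ⟨37265140, [51, 83, 172, 204], 0, [1, 4]⟩,
    ⟨32765140, [51, 83, 172, 204], 0, [1, 4]⟩,
    ⟨73265104, [51, 83, 172, 204], 0, [1, 4]⟩,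
    ⟨37265104, [51, 83, 172, 204], 0, [1, 4]⟩,
    ⟨32765104, [51, 83, 172, 204], 0, [1, 4]⟩]),
  ([15, 51, 204, 240], [
    ⟨76543210, [15, 51, 204, 240], 2, [1, 2, 2]⟩,
    ⟨54763210, [15, 60, 195, 240], 2, [1, 2, 2]⟩,
    ⟨76543210, [15, 51, 204, 240], 2, [1, 4]⟩,
    ⟨67543210, [15, 51, 204, 240], 2, [1, 4]⟩,
    ⟨54327610, [15, 60, 195, 240], 2, [1, 2, 2]⟩,
    ⟨32541076, [15, 60, 195, 240], 2, [1, 2, 2]⟩]),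
  ([23, 43, 204, 240], [
    ⟨76534210, [15, 51, 212, 232], 2, [1, 2, 2]⟩,
    ⟨32541076, [15, 60, 209, 226], 2, [1, 2, 2]⟩,
    ⟨76542130, [27, 45, 198, 240], 2, [5]⟩,
    ⟨67542130, [27, 45, 198, 240], 2, [5]⟩,
    ⟨76215403, [27, 45, 198, 240], 2, [5]⟩,
    ⟨67215403, [27, 45, 198, 240], 2, [5]⟩,
    ⟨43762150, [30, 99, 165, 216], 1, [2, 3]⟩,
    ⟨43217605, [30, 99, 165, 216], 1, [2, 3]⟩,
    ⟨43217650, [30, 99, 165, 216], 0, [2, 3]⟩,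
    ⟨43762105, [30, 99, 165, 216], 0, [2, 3]⟩,
    ⟨32675410, [60, 99, 204, 147], 0, [1, 4]⟩])]

lemma lastSteps_correct : lastSteps.all checkLast = true := by decide +kernel

lemma stepsThree_correct : stepsThree.all (checkStep (lastSteps.map Prod.fst)) = true := by
  decide +kernel

lemma stepsTwo_correct : stepsTwo.all (checkStep (stepsThree.map Prod.fst)) = true := by
  decide +kernel

lemma stepsOne_correct : stepsOne.all (checkStep (stepsTwo.map Prod.fst)) = true := by
  decide +kernel

lemma stepsZero_correct : stepsZero.all (checkStep (stepsOne.map Prod.fst)) = true := by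
  decide +kernel

lemma extensionsBounded_nil : ExtensionsBounded [] :=
  ExtensionsBounded.of_checkStep (.of_checkStep (.of_checkStep (.of_checkStep
    (.of_checkLast lastSteps_correct) stepsThree_correct) stepsTwo_correct) stepsOne_correct)
    stepsZero_correct [] (by simp [stepsZero])

lemma fourBounded {T : Fin 5 → Fin 4 → Fin 8} (hT : ∀ i, Function.Injective (T i)) :
    FourBounded T := by
  refine extensionsBounded_nil (List.ofFn fun i => rowMask (T i)) (fun m hm => ?_)
    (by simp) T hT (.refl _)
  obtain ⟨i, rfl⟩ := List.mem_ofFn.mp hm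
  exact ⟨T i, hT i, rfl⟩

/-- Any cross-ratio datum on 8 points (five 4-tuples of pairwise distinct indices,
covering every index) has cross-ratio degree at most 4. -/
theorem maxCrossRatioDegree_eight_points_le_four
    (T : Fin 5 → Fin 4 → Fin 8)
    (hT : ∀ i, Function.Injective (T i))
    (hcov : ∀ v : Fin 8, ∃ i j, T i j = v) :
    ∃ q : MvPolynomial (Fin 5) ℂ, q ≠ 0 ∧
      ∀ a : Fin 5 → ℂ, (∀ i, a i ≠ 0 ∧ a i ≠ 1) → MvPolynomial.eval a q ≠ 0 →
        let S : Set (Fin 8 → OnePoint ℂ) :=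
          {p | Function.Injective p ∧ p 0 = ∞ ∧ p 1 = ((0 : ℂ) : OnePoint ℂ) ∧
            p 2 = ((1 : ℂ) : OnePoint ℂ) ∧
            ∀ i, CR (p (T i 0)) (p (T i 1)) (p (T i 2)) (p (T i 3)) = a i}
        S.Finite ∧ S.ncard ≤ 4 := by
  obtain ⟨q, hq, h⟩ := (fourBounded hT).exists_polynomial hT
  exact ⟨q, hq, fun a _ ha => h a ha⟩
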